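/- arXiv:2605.24007 — 2 statements merged into one kernel-verified Lean document; each statement's English description precedes it below -/
import Mathlib

section
/- Let q, d ≥ 1 be integers. The fundamental group of the quotient space U(qd)/(I_q ⊗ U(d)) is a cyclic group of order q, i.e. isomorphic to ℤ/qℤ. -/
open Kronecker

lemma star_kronecker_star {q d : ℕ} (A : Matrix (Fin q) (Fin q) ℂ)
    (B : Matrix (Fin d) (Fin d) ℂ) : star (A ⊗ₖ B) = star A ⊗ₖ star B := by
  ext ⟨i, i'⟩ ⟨j, j'⟩
  simp [Matrix.star_apply, Matrix.kroneckerMap_apply, star_mul', Matrix.conjTranspose_apply,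
    mul_comm]

/-- The closed subgroup `I_q ⊗ U(d) = {I_q ⊗ v : v ∈ U(d)}` of `U(qd)`. -/
def oneTensorUnitary (q d : ℕ) : Subgroup (Matrix.unitaryGroup (Fin q × Fin d) ℂ) where
  carrier := {u | ∃ v : Matrix.unitaryGroup (Fin d) ℂ,
    (u : Matrix (Fin q × Fin d) (Fin q × Fin d) ℂ)
      = (1 : Matrix (Fin q) (Fin q) ℂ) ⊗ₖ (v : Matrix (Fin d) (Fin d) ℂ)}
  one_mem' := ⟨1, by simp [Matrix.one_kronecker_one]⟩
  mul_mem' := by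
    rintro a b ⟨v, hv⟩ ⟨w, hw⟩
    refine ⟨v * w, ?_⟩
    have hvw : ((v * w : Matrix.unitaryGroup (Fin d) ℂ) : Matrix (Fin d) (Fin d) ℂ)
        = (v : Matrix (Fin d) (Fin d) ℂ) * w := rfl
    rw [Matrix.UnitaryGroup.mul_val, hv, hw, hvw, ← Matrix.mul_kronecker_mul, one_mul]
  inv_mem' := by
    rintro a ⟨v, hv⟩
    refine ⟨v⁻¹, ?_⟩
    rw [Matrix.UnitaryGroup.inv_val, hv, star_kronecker_star, star_one,
      Matrix.UnitaryGroup.inv_val]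

section PolarPart
open scoped Matrix.Norms.L2Operator MatrixOrder ComplexOrder
variable {n : Type*} [Fintype n] [DecidableEq n]

noncomputable def polarPart (A : Matrix n n ℂ) : Matrix n n ℂ := A * (CFC.abs A)⁻¹

lemma det_cfcAbs_ne (A : Matrix n n ℂ) (hA : A.det ≠ 0) : (CFC.abs A).det ≠ 0 := by
  have h := congrArg Matrix.det (CFC.abs_mul_abs A)
  rw [Matrix.det_mul, Matrix.det_mul, Matrix.star_eq_conjTranspose, Matrix.det_conjTranspose] at h
  intro h0
  rw [h0] at h
  simp [hA] at h

lemma cfcAbs_star (A : Matrix n n ℂ) : star (CFC.abs A) = CFC.abs A :=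
  (IsSelfAdjoint.of_nonneg (CFC.abs_nonneg A)).star_eq

lemma polarPart_mem (A : Matrix n n ℂ) (hA : A.det ≠ 0) :
    polarPart A ∈ Matrix.unitaryGroup n ℂ := by
  rw [Matrix.mem_unitaryGroup_iff']
  have hu : IsUnit (CFC.abs A).det := (det_cfcAbs_ne A hA).isUnit
  have hs : star ((CFC.abs A)⁻¹) = (CFC.abs A)⁻¹ := by
    rw [Matrix.star_eq_conjTranspose, Matrix.conjTranspose_nonsing_inv,
      ← Matrix.star_eq_conjTranspose, cfcAbs_star]
  rw [polarPart, star_mul, hs, mul_assoc, ← mul_assoc (star A), ← CFC.abs_mul_abs,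
    mul_assoc, Matrix.mul_nonsing_inv _ hu, mul_one, Matrix.nonsing_inv_mul _ hu]

lemma cfcAbs_mul_unitary (A v : Matrix n n ℂ) (hv : v ∈ Matrix.unitaryGroup n ℂ) :
    CFC.abs (A * v) = star v * CFC.abs A * v := by
  have h1 : v * star v = 1 := Matrix.mem_unitaryGroup_iff.1 hv
  rw [CFC.abs]
  apply CFC.sqrt_unique
  · rw [star_mul]
    calc star v * CFC.abs A * v * (star v * CFC.abs A * v)
        = star v * CFC.abs A * (v * star v) * CFC.abs A * v := by simp only [mul_assoc]
      _ = star v * (CFC.abs A * CFC.abs A) * v := by rw [h1]; simp only [mul_assoc, one_mul]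
      _ = _ := by rw [CFC.abs_mul_abs]; simp only [mul_assoc]
  · exact star_left_conjugate_nonneg (CFC.abs_nonneg A) v

lemma polarPart_mul_unitary (A v : Matrix n n ℂ) (hv : v ∈ Matrix.unitaryGroup n ℂ) :
    polarPart (A * v) = polarPart A * v := by
  have h1 : v * star v = 1 := Matrix.mem_unitaryGroup_iff.1 hv
  have h2 : star v * v = 1 := Matrix.mem_unitaryGroup_iff'.1 hv
  have hvi : v⁻¹ = star v := Matrix.inv_eq_left_inv h2
  have hvi' : (star v)⁻¹ = v := Matrix.inv_eq_left_inv h1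
  rw [polarPart, cfcAbs_mul_unitary A v hv, Matrix.mul_inv_rev, Matrix.mul_inv_rev, hvi, hvi',
    polarPart, mul_assoc, ← mul_assoc v, h1, one_mul, mul_assoc]

lemma polarPart_one : polarPart (1 : Matrix n n ℂ) = 1 := by
  have : CFC.abs (1 : Matrix n n ℂ) = 1 := by
    rw [CFC.abs]; apply CFC.sqrt_unique
    · simp
    · exact zero_le_one
  simp [polarPart, this]

lemma polarPart_unitary (v : Matrix n n ℂ) (hv : v ∈ Matrix.unitaryGroup n ℂ) :
    polarPart v = v := by
  have := polarPart_mul_unitary 1 v hv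
  rwa [one_mul, polarPart_one, one_mul] at this

lemma det_polarPart (A : Matrix n n ℂ) (hA : A.det = 1) : (polarPart A).det = 1 := by
  have h := congrArg Matrix.det (CFC.abs_mul_abs A)
  rw [Matrix.det_mul, Matrix.det_mul, Matrix.star_eq_conjTranspose, Matrix.det_conjTranspose] at h
  have hp : 0 ≤ (CFC.abs A).det := (Matrix.nonneg_iff_posSemidef.1 (CFC.abs_nonneg A)).det_nonneg
  rw [hA] at h
  have h1 : (CFC.abs A).det = 1 := by
    rcases mul_self_eq_one_iff.1 (by simpa using h) with h | h
    · exact h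
    · rw [h] at hp
      exfalso
      have := (Complex.le_def.1 hp).1
      norm_num at this
  rw [polarPart, Matrix.det_mul, hA, Matrix.det_nonsing_inv, h1]
  simp

lemma continuousOn_polarPart :
    ContinuousOn (polarPart (n := n)) {A | A.det ≠ 0} := by
  intro A hA
  apply ContinuousAt.continuousWithinAt
  have h1 : ContinuousAt (CFC.abs : Matrix n n ℂ → Matrix n n ℂ) A :=
    CFC.continuous_abs.continuousAt
  have h2 : ContinuousAt (fun B : Matrix n n ℂ => B⁻¹) (CFC.abs A) := by
    apply continuousAt_matrix_inv
    have : (Ring.inverse : ℂ → ℂ) = fun x => x⁻¹ := by ext x; simp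
    rw [this]
    exact continuousAt_inv₀ (det_cfcAbs_ne A hA)
  exact continuousAt_id.mul (ContinuousAt.comp (f := CFC.abs) h2 h1)

end PolarPart

section NullLoops

lemma exists_nonvanishing_near (a : C(AddCircle (1:ℝ), ℂ)) (ε : ℝ) (hε : 0 < ε) :
    ∃ g : C(AddCircle (1:ℝ), ℂ), (∀ s, g s ≠ 0) ∧ ∀ s, ‖g s - a s‖ < ε := by
  have : Fact ((0:ℝ) < 1) := ⟨one_pos⟩
  have hd := span_fourier_closure_eq_top (T := (1:ℝ))
  have ha : a ∈ (Submodule.span ℂ (Set.range (@fourier (1:ℝ)))).topologicalClosure := by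
    rw [hd]; trivial
  rw [← SetLike.mem_coe, Submodule.topologicalClosure_coe, Metric.mem_closure_iff] at ha
  obtain ⟨p, hp, hpa⟩ := ha (ε / 2) (half_pos hε)
  have hc : ContDiff ℝ 1 (fun x : ℝ => p (x : AddCircle (1:ℝ))) := by
    refine Submodule.span_induction (p := fun p _ => ContDiff ℝ 1 (fun x : ℝ => p (x : AddCircle (1:ℝ))))
      ?_ ?_ ?_ ?_ hp
    · rintro _ ⟨k, rfl⟩
      simp only [fourier_coe_apply]
      have : ContDiff ℝ 1 (fun x : ℝ => (x : ℂ)) := Complex.ofRealCLM.contDiff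
      fun_prop
    · simpa using contDiff_const
    · intro x y _ _ hx hy
      simpa using hx.add hy
    · intro c x _ hx
      simpa using contDiff_const.mul hx
  have hdense := hc.dense_compl_range_of_finrank_lt_finrank (by simp)
  obtain ⟨c, hc1, hc2⟩ := hdense.exists_dist_lt 0 (half_pos hε)
  refine ⟨p - ContinuousMap.const _ c, ?_, ?_⟩
  · intro s
    obtain ⟨x, rfl⟩ := QuotientAddGroup.mk_surjective s
    intro h
    apply hc1
    refine ⟨x, ?_⟩
    simpa [sub_eq_zero] using h
  · intro s
    have h1 : ‖p s - a s‖ < ε / 2 := by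
      rw [← dist_eq_norm, dist_comm]
      exact lt_of_le_of_lt (ContinuousMap.dist_apply_le_dist s) hpa
    have h2 : ‖c‖ < ε / 2 := by simpa using hc2
    calc ‖(p - ContinuousMap.const (AddCircle (1:ℝ)) c) s - a s‖ = ‖(p s - a s) - c‖ := by
            simp only [ContinuousMap.sub_apply, ContinuousMap.const_apply]; congr 1; ring
      _ ≤ ‖p s - a s‖ + ‖c‖ := norm_sub_le _ _
      _ < ε := by linarith

/-- A map from the circle to `SL_n(ℂ)` which is homotopic to the identity. -/
def NullLoop {n : Type*} [Fintype n] [DecidableEq n]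
    (f : AddCircle (1:ℝ) → Matrix n n ℂ) : Prop :=
  ∃ F : unitInterval × AddCircle (1:ℝ) → Matrix n n ℂ, Continuous F ∧ (∀ x, (F x).det = 1) ∧
    (∀ s, F (0, s) = 1) ∧ ∀ s, F (1, s) = f s

variable {n : Type*} [Fintype n] [DecidableEq n]

lemma NullLoop.mul {f g : AddCircle (1:ℝ) → Matrix n n ℂ} (hf : NullLoop f) (hg : NullLoop g) :
    NullLoop (fun s => f s * g s) := by
  obtain ⟨F, h1, h2, h3, h4⟩ := hf
  obtain ⟨G, k1, k2, k3, k4⟩ := hg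
  exact ⟨fun x => F x * G x, h1.mul k1, fun x => by rw [Matrix.det_mul, h2, k2, one_mul],
    fun s => by simp [h3, k3], fun s => by simp [h4, k4]⟩

lemma NullLoop.of_mul {f g : AddCircle (1:ℝ) → Matrix n n ℂ} (hf : NullLoop f)
    (hg : NullLoop (fun s => f s * g s)) : NullLoop g := by
  obtain ⟨F, h1, h2, h3, h4⟩ := hf
  obtain ⟨G, k1, k2, k3, k4⟩ := hg
  refine ⟨fun x => (F x).adjugate * G x, h1.matrix_adjugate.mul k1,
    fun x => by rw [Matrix.det_mul, Matrix.det_adjugate, h2, k2, one_pow, one_mul],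
    fun s => by simp [h3, k3], fun s => ?_⟩
  have := Matrix.adjugate_mul (F (1, s))
  rw [h2, one_smul, h4] at this
  simp only
  rw [h4, k4, ← mul_assoc, this, one_mul]

lemma NullLoop.upper (y : AddCircle (1:ℝ) → Matrix Unit n ℂ) (hy : Continuous y) :
    NullLoop (fun s => Matrix.fromBlocks 1 (y s) 0 1) := by
  refine ⟨fun x => Matrix.fromBlocks 1 (((x.1 : ℝ) : ℂ) • y x.2) 0 1, ?_, ?_, ?_, ?_⟩
  · apply Continuous.matrix_fromBlocks <;> fun_prop
  · intro x; simp [Matrix.det_fromBlocks_zero₂₁]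
  · intro s; simp
  · intro s; simp

lemma NullLoop.lower (y : AddCircle (1:ℝ) → Matrix n Unit ℂ) (hy : Continuous y) :
    NullLoop (fun s => Matrix.fromBlocks 1 0 (y s) 1) := by
  refine ⟨fun x => Matrix.fromBlocks 1 0 (((x.1 : ℝ) : ℂ) • y x.2) 1, ?_, ?_, ?_, ?_⟩
  · apply Continuous.matrix_fromBlocks <;> fun_prop
  · intro x; simp [Matrix.det_fromBlocks_zero₁₂]
  · intro s; simp
  · intro s; simp

lemma NullLoop.block {f : AddCircle (1:ℝ) → Matrix n n ℂ} (hf : NullLoop f) :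
    NullLoop (fun s => (Matrix.fromBlocks 1 0 0 (f s) : Matrix (Unit ⊕ n) (Unit ⊕ n) ℂ)) := by
  obtain ⟨F, h1, h2, h3, h4⟩ := hf
  refine ⟨fun x => Matrix.fromBlocks 1 0 0 (F x), ?_, ?_, ?_, ?_⟩
  · apply Continuous.matrix_fromBlocks <;> fun_prop
  · intro x; simp [Matrix.det_fromBlocks_zero₁₂, h2]
  · intro s; simp [h3]
  · intro s; simp [h4]

lemma NullLoop.reindex {m : Type*} [Fintype m] [DecidableEq m] (e : n ≃ m)
    {f : AddCircle (1:ℝ) → Matrix m m ℂ}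
    (hf : NullLoop (fun s => (f s).submatrix e e)) : NullLoop f := by
  obtain ⟨F, h1, h2, h3, h4⟩ := hf
  refine ⟨fun x => (F x).submatrix e.symm e.symm, h1.matrix_submatrix _ _, ?_, ?_, ?_⟩
  · intro x; simp [h2]
  · intro s; simp [h3]
  · intro s; simp [h4]

/-- stable rank one for the circle -/
lemma exists_row (a : AddCircle (1:ℝ) → ℂ) (c : AddCircle (1:ℝ) → n → ℂ)
    (ha : Continuous a) (hc : Continuous c) (h : ∀ s, a s ≠ 0 ∨ c s ≠ 0) :
    ∃ y : AddCircle (1:ℝ) → n → ℂ, Continuous y ∧ ∀ s, a s + y s ⬝ᵥ c s ≠ 0 := by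
  have : Fact ((0:ℝ) < 1) := ⟨one_pos⟩
  let N : AddCircle (1:ℝ) → ℝ := fun s => ∑ i, ‖c s i‖ ^ 2
  have hN : Continuous N := by fun_prop
  have hN0 : ∀ s, 0 ≤ N s := fun s => by positivity
  have hNpos : ∀ s, c s ≠ 0 → 0 < N s := by
    intro s hs
    obtain ⟨i, hi⟩ := Function.ne_iff.1 hs
    apply Finset.sum_pos' (fun i _ => by positivity)
    exact ⟨i, Finset.mem_univ _, by have : 0 < ‖c s i‖ := norm_pos_iff.2 hi
                                    positivity⟩
  obtain ⟨s0, -, hs0⟩ := (isCompact_univ (X := AddCircle (1:ℝ))).exists_isMinOn Set.univ_nonempty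
    (f := fun s => max ‖a s‖ (N s)) (by fun_prop)
  set δ := max ‖a s0‖ (N s0) with hδ
  have hδ0 : 0 < δ := by
    rcases h s0 with h | h
    · exact lt_max_of_lt_left (norm_pos_iff.2 h)
    · exact lt_max_of_lt_right (hNpos _ h)
  have hmin : ∀ s, δ ≤ max ‖a s‖ (N s) := fun s => hs0 (Set.mem_univ s)
  obtain ⟨g, hg0, hg⟩ := exists_nonvanishing_near ⟨a, ha⟩ δ hδ0
  have hM : ∀ s, 0 < max (N s) δ := fun s => lt_max_of_lt_right hδ0
  refine ⟨fun s i => (g s - a s) * star (c s i) / ((max (N s) δ : ℝ) : ℂ), ?_, ?_⟩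
  · apply continuous_pi
    intro i
    apply Continuous.div
    · fun_prop
    · fun_prop
    · intro s; exact_mod_cast (hM s).ne'
  · intro s
    have hcalc : (fun i => (g s - a s) * star (c s i) / ((max (N s) δ : ℝ) : ℂ)) ⬝ᵥ c s
        = (g s - a s) * ((N s / max (N s) δ : ℝ) : ℂ) := by
      simp only [dotProduct, N]
      push_cast
      rw [Finset.sum_div, Finset.mul_sum]
      apply Finset.sum_congr rfl
      intro i _
      rw [← Complex.conj_mul' (c s i)]
      simp only [Complex.star_def]
      ring
    rw [hcalc]
    by_cases hle : δ ≤ N s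
    · rw [max_eq_left hle, div_self (by linarith)]
      simpa using hg0 s
    · push Not at hle
      rw [max_eq_right hle.le]
      have h1 : δ ≤ ‖a s‖ := by
        rcases le_max_iff.1 (hmin s) with h | h
        · exact h
        · linarith
      intro h0
      have h2 : a s = -((g s - a s) * ((N s / δ : ℝ) : ℂ)) := by linear_combination h0
      have h3 : ‖a s‖ = ‖g s - a s‖ * (N s / δ) := by
        conv_lhs => rw [h2]
        rw [norm_neg, norm_mul, Complex.norm_real, Real.norm_of_nonneg (by have := hN0 s; positivity)]
      have h4 : N s / δ ≤ 1 := by rw [div_le_one hδ0]; exact hle.le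
      have h5 := hg s
      simp only [ContinuousMap.coe_mk] at h5
      have h6 := mul_le_mul_of_nonneg_left h4 (norm_nonneg (g s - a s))
      linarith

lemma nullLoop_step [Nonempty n]
    (ih : ∀ f : AddCircle (1:ℝ) → Matrix n n ℂ, Continuous f → (∀ s, (f s).det = 1) → NullLoop f)
    (f : AddCircle (1:ℝ) → Matrix (Unit ⊕ n) (Unit ⊕ n) ℂ) (hf : Continuous f)
    (hdet : ∀ s, (f s).det = 1) : NullLoop f := by
  obtain ⟨i0⟩ := ‹Nonempty n›
  -- general final step
  have final : ∀ (b : AddCircle (1:ℝ) → Matrix Unit n ℂ) (D : AddCircle (1:ℝ) → Matrix n n ℂ),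
      Continuous b → Continuous D →
      (∀ s, (Matrix.fromBlocks (1 : Matrix Unit Unit ℂ) (b s) 0 (D s)).det = 1) →
      NullLoop (fun s => Matrix.fromBlocks (1 : Matrix Unit Unit ℂ) (b s) 0 (D s)) := by
    intro b D hb hD h
    have h1 := (ih D hD (fun s => by simpa [Matrix.det_fromBlocks_zero₂₁] using h s)).block
    have h2 := NullLoop.upper b hb
    have := h1.mul h2
    convert this using 2 with s
    simp [Matrix.fromBlocks_multiply]
  -- first column (1, e)
  let e : Matrix n Unit ℂ := fun i _ => if i = i0 then 1 else 0
  have step3 : ∀ (b : AddCircle (1:ℝ) → Matrix Unit n ℂ) (D : AddCircle (1:ℝ) → Matrix n n ℂ),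
      Continuous b → Continuous D →
      (∀ s, (Matrix.fromBlocks (1 : Matrix Unit Unit ℂ) (b s) e (D s)).det = 1) →
      NullLoop (fun s => Matrix.fromBlocks (1 : Matrix Unit Unit ℂ) (b s) e (D s)) := by
    intro b D hb hD h
    refine NullLoop.of_mul (NullLoop.lower (fun _ => -e) continuous_const) ?_
    have key : ∀ s, Matrix.fromBlocks 1 0 (-e) 1 *
        Matrix.fromBlocks (1 : Matrix Unit Unit ℂ) (b s) e (D s)
        = Matrix.fromBlocks (1 : Matrix Unit Unit ℂ) (b s) 0 (-e * b s + D s) := by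
      intro s; simp [Matrix.fromBlocks_multiply]
    have := final b (fun s => -e * b s + D s) hb (by fun_prop) (fun s => by
      rw [← key s, Matrix.det_mul, h s]; simp [Matrix.det_fromBlocks_zero₁₂])
    simpa only [key] using this
  -- first column (a, e)
  have step2 : ∀ (a : AddCircle (1:ℝ) → Matrix Unit Unit ℂ)
      (b : AddCircle (1:ℝ) → Matrix Unit n ℂ) (D : AddCircle (1:ℝ) → Matrix n n ℂ),
      Continuous a → Continuous b → Continuous D →
      (∀ s, (Matrix.fromBlocks (a s) (b s) e (D s)).det = 1) →
      NullLoop (fun s => Matrix.fromBlocks (a s) (b s) e (D s)) := by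
    intro a b D ha hb hD h
    let y : AddCircle (1:ℝ) → Matrix Unit n ℂ := fun s => (1 - a s) * e.transpose
    have hy : Continuous y := by fun_prop
    refine NullLoop.of_mul (NullLoop.upper y hy) ?_
    have hee : e.transpose * e = 1 := by
      have he : ∀ k u, e k u = if k = i0 then 1 else 0 := fun _ _ => rfl
      ext i j
      rw [Matrix.mul_apply]
      simp only [Matrix.transpose_apply, he]
      simp [Matrix.one_apply]
    have key : ∀ s, Matrix.fromBlocks 1 (y s) 0 1 * Matrix.fromBlocks (a s) (b s) e (D s)
        = Matrix.fromBlocks (1 : Matrix Unit Unit ℂ) (b s + y s * D s) e (D s) := by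
      intro s
      simp only [Matrix.fromBlocks_multiply, y, Matrix.mul_assoc, hee]
      simp
    have := step3 (fun s => b s + y s * D s) D (by fun_prop) hD (fun s => by
      rw [← key s, Matrix.det_mul, h s]; simp [Matrix.det_fromBlocks_zero₂₁])
    simpa only [key] using this
  -- first column (a, c) with a invertible
  have step1 : ∀ (a : AddCircle (1:ℝ) → Matrix Unit Unit ℂ)
      (b : AddCircle (1:ℝ) → Matrix Unit n ℂ) (c : AddCircle (1:ℝ) → Matrix n Unit ℂ)
      (D : AddCircle (1:ℝ) → Matrix n n ℂ),
      Continuous a → Continuous b → Continuous c → Continuous D →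
      (∀ s, a s () () ≠ 0) →
      (∀ s, (Matrix.fromBlocks (a s) (b s) (c s) (D s)).det = 1) →
      NullLoop (fun s => Matrix.fromBlocks (a s) (b s) (c s) (D s)) := by
    intro a b c D ha hb hc hD ha0 h
    let w : AddCircle (1:ℝ) → Matrix n Unit ℂ := fun s => (a s () ())⁻¹ • (e - c s)
    have hw : Continuous w := by
      refine Continuous.smul (f := fun s => (a s () ())⁻¹) (g := fun s => e - c s) ?_ ?_
      · apply Continuous.inv₀ _ ha0
        fun_prop
      · fun_prop
    refine NullLoop.of_mul (NullLoop.lower w hw) ?_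
    have hwa : ∀ s, w s * a s = e - c s := by
      intro s
      ext i j
      have := ha0 s
      simp [Matrix.mul_apply, w]
      field_simp
    have key : ∀ s, Matrix.fromBlocks 1 0 (w s) 1 * Matrix.fromBlocks (a s) (b s) (c s) (D s)
        = Matrix.fromBlocks (a s) (b s) e (w s * b s + D s) := by
      intro s
      simp only [Matrix.fromBlocks_multiply, hwa]
      simp
    have := step2 a b (fun s => w s * b s + D s) ha hb (by fun_prop) (fun s => by
      rw [← key s, Matrix.det_mul, h s]; simp [Matrix.det_fromBlocks_zero₁₂])
    simpa only [key] using this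
  -- start
  let a : AddCircle (1:ℝ) → Matrix Unit Unit ℂ := fun s => (f s).toBlocks₁₁
  let b : AddCircle (1:ℝ) → Matrix Unit n ℂ := fun s => (f s).toBlocks₁₂
  let c : AddCircle (1:ℝ) → Matrix n Unit ℂ := fun s => (f s).toBlocks₂₁
  let D : AddCircle (1:ℝ) → Matrix n n ℂ := fun s => (f s).toBlocks₂₂
  have hfe : ∀ i j, Continuous fun s => f s i j := fun i j => by fun_prop
  have ha : Continuous a := continuous_matrix fun i j => hfe _ _
  have hb : Continuous b := continuous_matrix fun i j => hfe _ _
  have hc : Continuous c := continuous_matrix fun i j => hfe _ _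
  have hD : Continuous D := continuous_matrix fun i j => hfe _ _
  have hfb : f = fun s => Matrix.fromBlocks (a s) (b s) (c s) (D s) := by
    ext1 s; exact (Matrix.fromBlocks_toBlocks (f s)).symm
  obtain ⟨y, hy, hy0⟩ := exists_row (fun s => a s () ()) (fun s i => c s i ())
    (hfe _ _) (continuous_pi fun i => hfe _ _) (by
      intro s
      by_contra hcon
      push Not at hcon
      have : (f s).det = 0 := by
        apply Matrix.det_eq_zero_of_column_eq_zero (Sum.inl ())
        rintro (⟨⟩ | i)
        · exact hcon.1
        · exact congrFun hcon.2 i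
      rw [hdet s] at this
      exact one_ne_zero this)
  let Y : AddCircle (1:ℝ) → Matrix Unit n ℂ := fun s _ i => y s i
  have hY : Continuous Y := continuous_matrix fun i j => by
    have := (continuous_apply j).comp hy
    exact this
  rw [hfb] at hdet ⊢
  refine NullLoop.of_mul (NullLoop.upper Y hY) ?_
  have key : ∀ s, Matrix.fromBlocks 1 (Y s) 0 1 * Matrix.fromBlocks (a s) (b s) (c s) (D s)
      = Matrix.fromBlocks (a s + Y s * c s) (b s + Y s * D s) (c s) (D s) := by
    intro s
    simp [Matrix.fromBlocks_multiply]
  have := step1 (fun s => a s + Y s * c s) (fun s => b s + Y s * D s) c D (by fun_prop)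
    (by fun_prop) hc hD (fun s => by
      have := hy0 s
      simpa [Matrix.mul_apply, dotProduct] using this) (fun s => by
    rw [← key s, Matrix.det_mul, hdet s]; simp [Matrix.det_fromBlocks_zero₂₁])
  simpa only [key] using this

lemma nullLoop_fin (k : ℕ) : ∀ f : AddCircle (1:ℝ) → Matrix (Fin k) (Fin k) ℂ, Continuous f →
    (∀ s, (f s).det = 1) → NullLoop f := by
  have sub : ∀ m : ℕ, m ≤ 1 → ∀ f : AddCircle (1:ℝ) → Matrix (Fin m) (Fin m) ℂ, Continuous f →
    (∀ s, (f s).det = 1) → NullLoop f := by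
    intro m hm f hf hd
    have : Subsingleton (Fin m) := by rw [Fin.subsingleton_iff_le_one]; exact hm
    have hf1 : ∀ s, f s = 1 := by
      intro s
      ext i j
      have h := hd s
      rw [Matrix.det_eq_elem_of_subsingleton (f s) i] at h
      rw [Subsingleton.elim j i, h]; simp
    exact ⟨fun _ => 1, continuous_const, by simp, by simp, by simp [hf1]⟩
  induction k with
  | zero => exact sub 0 (by norm_num)
  | succ k ih =>
    rcases Nat.eq_zero_or_pos k with rfl | hk
    · exact sub 1 le_rfl
    · intro f hf hd
      have : Nonempty (Fin k) := ⟨⟨0, hk⟩⟩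
      let e : Unit ⊕ Fin k ≃ Fin (k + 1) := Fintype.equivOfCardEq (by simp [add_comm])
      apply NullLoop.reindex e
      apply nullLoop_step ih
      · exact hf.matrix_submatrix _ _
      · intro s; simp [hd]

lemma nullLoop_of_det (f : AddCircle (1:ℝ) → Matrix n n ℂ) (hf : Continuous f)
    (hd : ∀ s, (f s).det = 1) : NullLoop f := by
  apply NullLoop.reindex (Fintype.equivFin n).symm
  apply nullLoop_fin
  · exact hf.matrix_submatrix _ _
  · intro s; simp [hd]

end NullLoops

section SpecialUnitary
variable {n : Type*} [Fintype n] [DecidableEq n]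

/-- The special unitary group as a subgroup of the unitary group. -/
def SUg (n : Type*) [Fintype n] [DecidableEq n] : Subgroup (Matrix.unitaryGroup n ℂ) where
  carrier := {g | (g : Matrix n n ℂ).det = 1}
  one_mem' := by simp
  mul_mem' := by
    intro a b ha hb
    simp only [Set.mem_setOf_eq] at *
    rw [Matrix.UnitaryGroup.mul_val, Matrix.det_mul, ha, hb, one_mul]
  inv_mem' := by
    intro a ha
    simp only [Set.mem_setOf_eq] at *
    rw [Matrix.UnitaryGroup.inv_val, Matrix.star_eq_conjTranspose, Matrix.det_conjTranspose, ha,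
      star_one]

lemma exists_SU_homotopy (f : AddCircle (1:ℝ) → SUg n) (hf : Continuous f) :
    ∃ U : unitInterval × AddCircle (1:ℝ) → SUg n, Continuous U ∧ (∀ s, U (0, s) = 1) ∧
      ∀ s, U (1, s) = f s := by
  obtain ⟨F, hF, hdet, h0, h1⟩ := nullLoop_of_det (fun s => ((f s : Matrix.unitaryGroup n ℂ) : Matrix n n ℂ))
    (by fun_prop) (fun s => (f s).2)
  have hne : ∀ x, (F x).det ≠ 0 := fun x => by rw [hdet]; exact one_ne_zero
  refine ⟨fun x => ⟨⟨polarPart (F x), polarPart_mem _ (hne x)⟩, det_polarPart _ (hdet x)⟩,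
    ?_, ?_, ?_⟩
  · refine Continuous.subtype_mk (Continuous.subtype_mk ?_ _) _
    exact continuousOn_polarPart.comp_continuous hF hne
  · intro s
    apply Subtype.ext; apply Subtype.ext
    simp only [h0, polarPart_one]
    rfl
  · intro s
    apply Subtype.ext; apply Subtype.ext
    simp only [h1]
    exact polarPart_unitary _ (f s).1.2

lemma SU_joined (g : SUg n) : Joined 1 g := by
  obtain ⟨U, hU, h0, h1⟩ := exists_SU_homotopy (fun _ => g) continuous_const
  exact ⟨⟨⟨fun t => U (t, 0), by fun_prop⟩, h0 0, h1 0⟩⟩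

instance SU_pathConnected : PathConnectedSpace (SUg n) where
  nonempty := ⟨1⟩
  joined x y := (SU_joined x).symm.trans (SU_joined y)

instance SU_simplyConnected : SimplyConnectedSpace (SUg n) := by
  rw [simply_connected_iff_loops_nullhomotopic]
  refine ⟨inferInstance, fun x γ => ?_⟩
  have hf0 : γ.extend 0 = γ.extend 1 := by simp
  have hc : Continuous (AddCircle.liftIco (1:ℝ) 0 γ.extend) :=
    AddCircle.liftIco_zero_continuous hf0 γ.continuous_extend.continuousOn
  have hv : ∀ s : unitInterval, AddCircle.liftIco (1:ℝ) 0 γ.extend ((s : ℝ) : AddCircle (1:ℝ)) = γ s := by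
    intro s
    rcases s.2.2.lt_or_eq with h | h
    · rw [AddCircle.liftIco_zero_coe_apply ⟨s.2.1, h⟩]
      simp
    · have : s = 1 := Subtype.ext h
      subst this
      have e : (((1 : unitInterval) : ℝ) : AddCircle (1:ℝ)) = ((0:ℝ) : AddCircle (1:ℝ)) := by
        simpa using AddCircle.coe_period (1:ℝ)
      rw [e, AddCircle.liftIco_zero_coe_apply ⟨le_rfl, one_pos⟩]
      simp
  obtain ⟨U, hU, h0, h1⟩ := exists_SU_homotopy _ hc
  have hq : Continuous (fun s : unitInterval => ((s : ℝ) : AddCircle (1:ℝ))) :=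
    (AddCircle.continuous_mk' (1:ℝ)).comp continuous_subtype_val
  have h10 : (((1 : unitInterval) : ℝ) : AddCircle (1:ℝ)) = 0 := by
    simpa using AddCircle.coe_period (1:ℝ)
  have h1' : ∀ s : unitInterval, U (1, ((s : ℝ) : AddCircle (1:ℝ))) = γ s := fun s => by
    rw [h1, hv]
  have h10' : U (1, (0 : AddCircle (1:ℝ))) = x := by
    have := h1' 0
    simpa using this
  refine Path.Homotopic.symm ⟨{
    toFun := fun p => x * (U (p.1, 0))⁻¹ * U (p.1, ((p.2 : ℝ) : AddCircle (1:ℝ)))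
    continuous_toFun := ?_
    map_zero_left := ?_
    map_one_left := ?_
    prop' := ?_ }⟩
  · have : Continuous (fun p : unitInterval × unitInterval =>
        (p.1, ((p.2 : ℝ) : AddCircle (1:ℝ)))) :=
      continuous_fst.prodMk (hq.comp continuous_snd)
    exact (continuous_const.mul (hU.comp (continuous_fst.prodMk continuous_const)).inv).mul
      (hU.comp this)
  · intro s; simp [h0]
  · intro s; simp [h1', h10']
  · intro t s hs
    rcases hs with rfl | rfl
    · simp
    · have h := AddCircle.coe_period (1:ℝ)
      simp [h]

end SpecialUnitary

section AbstractCoset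
variable {S : Type*} [Group S] [TopologicalSpace S] [IsTopologicalGroup S] (K : Subgroup S)

open unitInterval in
lemma exists_path_lift_coset (W : Set S) (hW : IsOpen W) (h1 : (1 : S) ∈ W)
    (hWK : ∀ g ∈ W, ∀ k ∈ K, g * k ∈ W) (r : S → S) (hr : ContinuousOn r W)
    (hrK : ∀ g ∈ W, r g ∈ K) (hrm : ∀ g ∈ W, ∀ k ∈ K, r (g * k) = r g * k)
    (γ : C(I, S ⧸ K)) (e : S) (γ_0 : γ 0 = (e : S ⧸ K)) :
    ∃ Γ : C(I, S), (∀ t, (Γ t : S ⧸ K) = γ t) ∧ Γ 0 = e := by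
  let V : Set (S ⧸ K) := (QuotientGroup.mk : S → S ⧸ K) '' W
  have hV : IsOpen V := QuotientGroup.isOpenMap_coe _ hW
  -- section over `V`
  obtain ⟨sc, hsc, hscm⟩ : ∃ sc : S ⧸ K → S, ContinuousOn sc V ∧ ∀ x ∈ V, (sc x : S ⧸ K) = x := by
    have key : ∀ g ∈ W, (fun g => g * (r g)⁻¹) (Quotient.out (g : S ⧸ K)) = g * (r g)⁻¹ := by
      intro g hg
      obtain ⟨k, hk⟩ := QuotientGroup.mk_out_eq_mul K g
      have hk' : Quotient.out (g : S ⧸ K) = g * k := hk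
      simp only [hk', hrm g hg k k.2]
      group
    refine ⟨fun x => (fun g => g * (r g)⁻¹) (Quotient.out x), ?_, ?_⟩
    · rintro _ ⟨g, hg, rfl⟩
      apply ContinuousAt.continuousWithinAt
      rw [← QuotientGroup.isOpenQuotientMap_mk.continuousAt_comp_iff]
      have hc : ContinuousAt (fun g => g * (r g)⁻¹) g :=
        continuousAt_id.mul (hr.continuousAt (hW.mem_nhds hg)).inv
      refine hc.congr ?_
      filter_upwards [hW.mem_nhds hg] with a ha
      exact (key a ha).symm
    · rintro _ ⟨g, hg, rfl⟩
      have := key g hg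
      simp only at this
      simp only [this]
      rw [QuotientGroup.eq]
      simpa using hrK g hg
  obtain ⟨t, t_0, t_mono, ⟨n_max, h_max⟩, t_sub⟩ :=
    exists_monotone_Icc_subset_open_cover_unitInterval
    (c := fun a : S => {s : I | a⁻¹ • γ s ∈ V})
    (fun a ↦ hV.preimage (γ.continuous.const_smul a⁻¹)) (fun s _ ↦ by
      obtain ⟨a, ha⟩ := QuotientGroup.mk_surjective (γ s)
      refine Set.mem_iUnion.2 ⟨a, 1, h1, ?_⟩
      rw [← ha, MulAction.Quotient.smul_coe]
      simp)
  suffices ∀ n, ∃ Γ : I → S, ContinuousOn Γ (Set.Icc 0 (t n)) ∧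
      (∀ s ∈ Set.Icc 0 (t n), (Γ s : S ⧸ K) = γ s) ∧ Γ 0 = e by
    obtain ⟨Γ, cont, eqOn, Γ_0⟩ := this n_max
    rw [h_max _ le_rfl] at cont eqOn
    exact ⟨⟨Γ, continuousOn_univ.mp
      (by convert! cont; rw [eq_comm, Set.eq_univ_iff_forall]; exact fun t ↦ ⟨bot_le, le_top⟩)⟩,
      fun _ ↦ eqOn _ ⟨bot_le, le_top⟩, Γ_0⟩
  intro n
  induction n with
  | zero =>
    refine ⟨fun _ ↦ e, continuous_const.continuousOn, fun t ht ↦ ?_, rfl⟩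
    rw [t_0, Set.Icc_self, Set.mem_singleton_iff] at ht; subst ht; exact γ_0.symm
  | succ n ih => ?_
  obtain ⟨Γ, cont, eqOn, Γ_0⟩ := ih
  obtain ⟨a, t_sub⟩ := t_sub n
  have pΓtn : (Γ (t n) : S ⧸ K) = γ (t n) := eqOn _ ⟨t_0 ▸ t_mono n.zero_le, le_rfl⟩
  -- local lift
  let τ : I → S := fun s => a * sc (a⁻¹ • γ s)
  have hτ : ContinuousOn τ (Set.Icc (t n) (t (n+1))) := by
    refine continuousOn_const.mul (hsc.comp (γ.continuous.const_smul a⁻¹).continuousOn ?_)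
    exact fun s hs => t_sub hs
  have hτm : ∀ s ∈ Set.Icc (t n) (t (n+1)), (τ s : S ⧸ K) = γ s := by
    intro s hs
    have := hscm _ (t_sub hs)
    have h2 : (τ s : S ⧸ K) = a • (sc (a⁻¹ • γ s) : S ⧸ K) := rfl
    rw [h2, this, smul_inv_smul]
  let k : S := (τ (t n))⁻¹ * Γ (t n)
  have hk : k ∈ K := by
    have : (τ (t n) : S ⧸ K) = Γ (t n) := by
      rw [pΓtn, hτm _ ⟨le_rfl, t_mono n.le_succ⟩]
    exact QuotientGroup.eq.mp this
  refine ⟨fun s ↦ if s ≤ t n then Γ s else τ s * k,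
    .if (fun s hs ↦ ?_) (cont.mono fun _ h ↦ ?_) ?_, fun s hs ↦ ?_, ?_⟩
  · cases frontier_Iic_subset _ hs.2
    simp [k]
  · rw [closure_le_eq continuous_id' continuous_const] at h; exact ⟨h.1.1, h.2⟩
  · refine ContinuousOn.mono (hτ.mul continuousOn_const) ?_
    simp_rw [not_le]; intro s h
    exact ⟨closure_lt_subset_le continuous_const continuous_subtype_val h.2, h.1.2⟩
  · dsimp only; split_ifs with h
    · exact eqOn _ ⟨hs.1, h⟩
    · rw [QuotientGroup.mk_mul_of_mem _ hk]
      exact hτm s ⟨le_of_not_ge h, hs.2⟩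
  · dsimp only; rwa [if_pos (t_0 ▸ t_mono n.zero_le)]

open unitInterval in
lemma simplyConnected_coset [SimplyConnectedSpace S] (hK : ∀ k : K, Joined 1 k)
    (hl : ∀ (γ : C(I, S ⧸ K)) (e : S), γ 0 = (e : S ⧸ K) →
      ∃ Γ : C(I, S), (∀ t, (Γ t : S ⧸ K) = γ t) ∧ Γ 0 = e) :
    SimplyConnectedSpace (S ⧸ K) := by
  rw [simply_connected_iff_loops_nullhomotopic]
  have hc : Continuous (QuotientGroup.mk : S → S ⧸ K) := QuotientGroup.continuous_mk
  have hpc : PathConnectedSpace S := inferInstance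
  refine ⟨QuotientGroup.mk_surjective.pathConnectedSpace hc, fun x γ => ?_⟩
  obtain ⟨e, rfl⟩ := QuotientGroup.mk_surjective x
  obtain ⟨Γ, hΓ, hΓ0⟩ := hl γ e γ.source
  have hk : e⁻¹ * Γ 1 ∈ K := by
    apply QuotientGroup.eq.mp
    rw [hΓ]; exact γ.target.symm
  obtain ⟨κ⟩ := hK ⟨_, hk⟩
  let L : Path e e :=
    { toFun := fun t => Γ t * ((κ t : K) : S)⁻¹
      continuous_toFun := by fun_prop
      source' := by simp [hΓ0]
      target' := by simp }
  have hL : γ = L.map hc := by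
    ext t
    have h : (L t : S ⧸ K) = Γ t := QuotientGroup.mk_mul_of_mem _ (K.inv_mem (κ t).2)
    exact (h.trans (hΓ t)).symm
  have := (SimplyConnectedSpace.paths_homotopic L (Path.refl e)).map ⟨_, hc⟩
  rw [hL]
  exact this

end AbstractCoset

section Covering

lemma det_mem_circle {n : Type*} [Fintype n] [DecidableEq n] (g : Matrix.unitaryGroup n ℂ) :
    (g : Matrix n n ℂ).det ∈ Submonoid.unitSphere ℂ := by
  have h := Matrix.det_of_mem_unitary g.2
  have h2 : star (g : Matrix n n ℂ).det * (g : Matrix n n ℂ).det = 1 :=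
    (Unitary.mem_iff.mp h).1
  have h3 : ‖star (g : Matrix n n ℂ).det * (g : Matrix n n ℂ).det‖ = 1 := by rw [h2]; simp
  rw [norm_mul, norm_star] at h3
  have : ‖(g : Matrix n n ℂ).det‖ = 1 := by nlinarith [norm_nonneg (g : Matrix n n ℂ).det]
  simpa [Submonoid.unitSphere] using this

/-- The determinant of a unitary matrix as an element of the circle. -/
noncomputable def detC {n : Type*} [Fintype n] [DecidableEq n] (g : Matrix.unitaryGroup n ℂ) :
    Circle := ⟨(g : Matrix n n ℂ).det, det_mem_circle g⟩

instance compactSpace_unitary {n : Type*} [Fintype n] [DecidableEq n] :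
    CompactSpace (Matrix.unitaryGroup n ℂ) := by
  refine (isCompact_iff_compactSpace (s := (Matrix.unitaryGroup n ℂ : Set (Matrix n n ℂ)))).mp ?_
  have hK : IsCompact (Set.univ.pi fun _ : n => Set.univ.pi fun _ : n =>
      Metric.closedBall (0:ℂ) 1) :=
    isCompact_univ_pi fun _ => isCompact_univ_pi fun _ => isCompact_closedBall _ _
  refine IsCompact.of_isClosed_subset (s := Set.univ.pi fun _ : n => Set.univ.pi fun _ : n =>
      Metric.closedBall (0:ℂ) 1) hK ?_ ?_
  · have : (↑(Matrix.unitaryGroup n ℂ) : Set (Matrix n n ℂ)) = {A | star A * A = 1} := by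
      ext A
      exact Matrix.mem_unitaryGroup_iff'
    exact this ▸ isClosed_eq (by fun_prop) continuous_const
  · intro A hA i _ j _
    simpa using entry_norm_bound_of_unitary hA i j

instance compactSpace_SU {n : Type*} [Fintype n] [DecidableEq n] : CompactSpace (SUg n) := by
  have : IsClosed (SUg n : Set (Matrix.unitaryGroup n ℂ)) := by
    have h : (SUg n : Set (Matrix.unitaryGroup n ℂ)) =
      {g : Matrix.unitaryGroup n ℂ | (g : Matrix n n ℂ).det = 1} := rfl
    exact h ▸ isClosed_eq (by fun_prop) continuous_const
  exact isCompact_iff_compactSpace.mp this.isCompact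

/-- The embedding `v ↦ I_q ⊗ v`. -/
def tens (q d : ℕ) : Matrix.unitaryGroup (Fin d) ℂ →* Matrix.unitaryGroup (Fin q × Fin d) ℂ where
  toFun v := ⟨(1 : Matrix (Fin q) (Fin q) ℂ) ⊗ₖ (v : Matrix (Fin d) (Fin d) ℂ), by
    rw [Matrix.mem_unitaryGroup_iff, star_kronecker_star, star_one, ← Matrix.mul_kronecker_mul,
      Matrix.mem_unitaryGroup_iff.mp v.2, one_mul, Matrix.one_kronecker_one]⟩
  map_one' := by
    apply Subtype.ext
    simp [Matrix.one_kronecker_one]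
  map_mul' v w := by
    apply Subtype.ext
    simp only [Matrix.UnitaryGroup.mul_val]
    rw [← Matrix.mul_kronecker_mul, one_mul]

lemma tens_val (q d : ℕ) (v : Matrix.unitaryGroup (Fin d) ℂ) :
    (tens q d v : Matrix (Fin q × Fin d) (Fin q × Fin d) ℂ) = (1 : Matrix (Fin q) (Fin q) ℂ) ⊗ₖ (v : Matrix (Fin d) (Fin d) ℂ) :=
  rfl

lemma tens_injective (q d : ℕ) [NeZero q] : Function.Injective (tens q d) := by
  intro v w h
  apply Subtype.ext
  ext i j
  have := congrFun (congrFun (congrArg Subtype.val h) (0, i)) (0, j)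
  simpa [tens_val, Matrix.kroneckerMap_apply] using this

lemma continuous_tens (q d : ℕ) : Continuous (tens q d) := by
  refine Continuous.subtype_mk ?_ _
  refine continuous_matrix fun i j => ?_
  simp only [Matrix.kroneckerMap_apply]
  exact continuous_const.mul (Continuous.matrix_elem continuous_subtype_val _ _)

lemma det_tens (q d : ℕ) (v : Matrix.unitaryGroup (Fin d) ℂ) :
    (tens q d v : Matrix (Fin q × Fin d) (Fin q × Fin d) ℂ).det = (v : Matrix (Fin d) (Fin d) ℂ).det ^ q := by
  rw [tens_val, Matrix.det_kronecker]; simp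

lemma mem_oneTensorUnitary (q d : ℕ) (g : Matrix.unitaryGroup (Fin q × Fin d) ℂ) :
    g ∈ oneTensorUnitary q d ↔ ∃ v, tens q d v = g := by
  constructor
  · rintro ⟨v, hv⟩; exact ⟨v, Subtype.ext hv.symm⟩
  · rintro ⟨v, rfl⟩; exact ⟨v, rfl⟩

/-- The subgroup `I_q ⊗ SU(d)` of `SU(qd)`. -/
def KS (q d : ℕ) : Subgroup (SUg (Fin q × Fin d)) :=
  ((SUg (Fin d)).map (tens q d)).subgroupOf (SUg (Fin q × Fin d))

lemma mem_KS (q d : ℕ) (g : SUg (Fin q × Fin d)) :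
    g ∈ KS q d ↔ ∃ v ∈ SUg (Fin d), tens q d v = g := by
  rw [KS, Subgroup.mem_subgroupOf, Subgroup.mem_map]

lemma tens_mem_SU (q d : ℕ) (v : SUg (Fin d)) : tens q d v ∈ SUg (Fin q × Fin d) := by
  change (tens q d v : Matrix (Fin q × Fin d) (Fin q × Fin d) ℂ).det = 1
  rw [det_tens, show ((v : Matrix.unitaryGroup (Fin d) ℂ) : Matrix (Fin d) (Fin d) ℂ).det = 1 from v.2, one_pow]

/-- The map `SU(d) → I_q ⊗ SU(d)`. -/
def toKS (q d : ℕ) (v : SUg (Fin d)) : KS q d :=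
  ⟨⟨tens q d v, tens_mem_SU q d v⟩, (mem_KS q d _).2 ⟨v, v.2, rfl⟩⟩

lemma continuous_toKS (q d : ℕ) : Continuous (toKS q d) :=
  ((((continuous_tens q d).comp continuous_subtype_val).subtype_mk _).subtype_mk _)

lemma toKS_surjective (q d : ℕ) : Function.Surjective (toKS q d) := by
  rintro ⟨g, hg⟩
  obtain ⟨v, hv, h⟩ := (mem_KS q d g).1 hg
  exact ⟨⟨v, hv⟩, Subtype.ext (Subtype.ext h)⟩

lemma KS_joined (q d : ℕ) (k : KS q d) : Joined 1 k := by
  obtain ⟨v, rfl⟩ := toKS_surjective q d k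
  have h1 : (1 : KS q d) = toKS q d 1 := by
    apply Subtype.ext; apply Subtype.ext
    simp [toKS]
  rw [h1]
  exact (SU_joined v).map (continuous_toKS q d)

lemma isClosed_KS (q d : ℕ) : IsClosed (KS q d : Set (SUg (Fin q × Fin d))) := by
  have : (KS q d : Set (SUg (Fin q × Fin d))) = Set.range (fun v => (toKS q d v : SUg (Fin q × Fin d))) := by
    ext g
    constructor
    · intro hg
      obtain ⟨v, hv⟩ := toKS_surjective q d ⟨g, hg⟩
      exact ⟨v, congrArg Subtype.val hv⟩
    · rintro ⟨v, rfl⟩; exact (toKS q d v).2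
  rw [this]
  exact (isCompact_range (continuous_subtype_val.comp (continuous_toKS q d))).isClosed

instance t2_SU_KS (q d : ℕ) : T2Space (SUg (Fin q × Fin d) ⧸ KS q d) := by
  rw [t2Space_iff_of_isOpenQuotientMap QuotientGroup.isOpenQuotientMap_mk]
  have : {p : SUg (Fin q × Fin d) × SUg (Fin q × Fin d) |
      (p.1 : SUg (Fin q × Fin d) ⧸ KS q d) = p.2} = (fun p => p.1⁻¹ * p.2) ⁻¹' (KS q d : Set _) := by
    ext p
    exact QuotientGroup.eq
  rw [this]
  exact (isClosed_KS q d).preimage (by fun_prop)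

/-- The diagonal matrix `diag(w, 1, …, 1)`. -/
def dlt (d : ℕ) [NeZero d] : Circle →* Matrix.unitaryGroup (Fin d) ℂ where
  toFun w := ⟨Matrix.diagonal (fun i => if i = 0 then (w : ℂ) else 1), by
    rw [Matrix.mem_unitaryGroup_iff, Matrix.star_eq_conjTranspose, Matrix.diagonal_conjTranspose,
      Matrix.diagonal_mul_diagonal, ← Matrix.diagonal_one]
    congr 1
    ext i
    by_cases h : i = 0
    · simp only [h, if_true, Pi.star_apply, Complex.star_def, Complex.mul_conj, Circle.normSq_coe,
        Complex.ofReal_one]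
    · simp [h]⟩
  map_one' := by
    apply Subtype.ext
    simp
  map_mul' v w := by
    apply Subtype.ext
    simp only [Matrix.UnitaryGroup.mul_val, Matrix.diagonal_mul_diagonal]
    congr 1
    ext i
    split_ifs <;> simp

lemma dlt_val (d : ℕ) [NeZero d] (w : Circle) : (dlt d w : Matrix (Fin d) (Fin d) ℂ) =
    Matrix.diagonal (fun i => if i = 0 then (w : ℂ) else 1) := rfl

lemma det_dlt (d : ℕ) [NeZero d] (w : Circle) : (dlt d w : Matrix (Fin d) (Fin d) ℂ).det = w := by
  rw [dlt_val, Matrix.det_diagonal]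
  simp

lemma continuous_dlt (d : ℕ) [NeZero d] : Continuous (dlt d) := by
  refine Continuous.subtype_mk ?_ _
  refine Continuous.matrix_diagonal ?_
  refine continuous_pi fun i => ?_
  split_ifs
  · fun_prop
  · fun_prop

end Covering

section Final
variable (q d : ℕ) [NeZero q] [NeZero d]

/-- Partial trace over the first factor. -/
def ptr (q d : ℕ) (A : Matrix (Fin q × Fin d) (Fin q × Fin d) ℂ) : Matrix (Fin d) (Fin d) ℂ :=
  fun i j => ∑ k, A (k, i) (k, j)

lemma continuous_ptr : Continuous (ptr q d) := by
  refine continuous_matrix fun i j => ?_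
  exact continuous_finsetSum _ fun k _ => continuous_id.matrix_elem _ _

lemma ptr_mul (A : Matrix (Fin q × Fin d) (Fin q × Fin d) ℂ) (v : Matrix (Fin d) (Fin d) ℂ) :
    ptr q d (A * ((1 : Matrix (Fin q) (Fin q) ℂ) ⊗ₖ v)) = ptr q d A * v := by
  ext i j
  simp only [ptr, Matrix.mul_apply, Matrix.kroneckerMap_apply, Fintype.sum_prod_type,
    Matrix.one_apply]
  simp only [ite_mul, one_mul, zero_mul, mul_ite, mul_zero]
  simp only [Finset.sum_mul]
  rw [Finset.sum_comm]
  conv_rhs => rw [Finset.sum_comm]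
  rw [Finset.sum_comm]
  refine Finset.sum_congr rfl fun k _ => ?_
  rw [Finset.sum_eq_single k]
  · simp
  · intro b _ hb; simp [hb]
  · simp

lemma det_ptr_one : (ptr q d 1).det ≠ 0 := by
  have : ptr q d 1 = (q : ℂ) • (1 : Matrix (Fin d) (Fin d) ℂ) := by
    ext i j
    by_cases h : i = j <;> simp [ptr, Matrix.one_apply, h]
  rw [this, Matrix.det_smul]
  simp [NeZero.ne q]

open unitInterval in
instance simplyConnected_SU_KS : SimplyConnectedSpace (SUg (Fin q × Fin d) ⧸ KS q d) := by
  refine simplyConnected_coset (KS q d) (KS_joined q d) ?_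
  let T : SUg (Fin q × Fin d) → Matrix (Fin d) (Fin d) ℂ := fun g =>
    ptr q d ((g : Matrix.unitaryGroup (Fin q × Fin d) ℂ) : Matrix (Fin q × Fin d) (Fin q × Fin d) ℂ)
  have hT : Continuous T := (continuous_ptr q d).comp (by fun_prop)
  have hTm : ∀ g (v : SUg (Fin d)), T (g * toKS q d v) = T g * ((v : Matrix.unitaryGroup (Fin d) ℂ) : Matrix (Fin d) (Fin d) ℂ) :=
    fun g v => ptr_mul q d _ _
  let W : Set (SUg (Fin q × Fin d)) := {g | (T g).det ≠ 0}
  have hW : IsOpen W := isOpen_ne_fun (by fun_prop) continuous_const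
  let u : ∀ g : SUg (Fin q × Fin d), g ∈ W → Matrix.unitaryGroup (Fin d) ℂ := fun g hg =>
    ⟨polarPart (T g), polarPart_mem _ hg⟩
  have hu : ∀ g hg, (dlt d (detC (u g hg)))⁻¹ * u g hg ∈ SUg (Fin d) := by
    intro g hg
    change (((dlt d (detC (u g hg)))⁻¹ * u g hg : Matrix.unitaryGroup (Fin d) ℂ) : Matrix (Fin d) (Fin d) ℂ).det = 1
    rw [← map_inv, Matrix.UnitaryGroup.mul_val, Matrix.det_mul, det_dlt, Circle.coe_inv]
    exact inv_mul_cancel₀ (Circle.coe_ne_zero _)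
  classical
  let r : SUg (Fin q × Fin d) → SUg (Fin q × Fin d) := fun g =>
    if hg : g ∈ W then toKS q d ⟨_, hu g hg⟩ else 1
  have hr : ∀ g (hg : g ∈ W), r g = toKS q d ⟨_, hu g hg⟩ := fun g hg => dif_pos hg
  have hWK : ∀ g ∈ W, ∀ k ∈ KS q d, g * k ∈ W := by
    intro g hg k hk
    obtain ⟨v, hv⟩ := toKS_surjective q d ⟨k, hk⟩
    have hv : k = toKS q d v := (congrArg Subtype.val hv).symm
    change (T (g * k)).det ≠ 0
    rw [hv, hTm, Matrix.det_mul, show ((v : Matrix.unitaryGroup (Fin d) ℂ) : Matrix (Fin d) (Fin d) ℂ).det = 1 from v.2, mul_one]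
    exact hg
  intro γ e he
  refine exists_path_lift_coset (KS q d) W hW ?_ hWK r ?_ ?_ ?_ γ e he
  · exact det_ptr_one q d
  · rw [continuousOn_iff_continuous_domRestrict]
    have hu' : Continuous (fun g : W => u g g.2) := by
      refine Continuous.subtype_mk ?_ _
      exact continuousOn_polarPart.comp_continuous (hT.comp continuous_subtype_val) (fun g => g.2)
    have hdet : Continuous (fun g : W => detC (u g g.2)) := by
      refine Continuous.subtype_mk ?_ _
      exact Continuous.matrix_det (continuous_subtype_val.comp hu')
    have : W.domRestrict r = fun g : W => ((toKS q d ⟨_, hu g g.2⟩ : KS q d) : SUg (Fin q × Fin d)) := by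
      ext1 g; exact hr g g.2
    rw [this]
    refine continuous_subtype_val.comp ((continuous_toKS q d).comp (Continuous.subtype_mk ?_ _))
    exact ((continuous_dlt d).comp hdet).inv.mul hu'
  · intro g hg
    rw [hr g hg]; exact (toKS q d _).2
  · intro g hg k hk
    have hgk := hWK g hg k hk
    rw [hr g hg, hr _ hgk]
    obtain ⟨v, hv⟩ := toKS_surjective q d ⟨k, hk⟩
    have hv : k = toKS q d v := (congrArg Subtype.val hv).symm
    subst hv
    have h1 : u _ hgk = u g hg * v := by
      apply Subtype.ext
      change polarPart (T (g * toKS q d v)) = polarPart (T g) * _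
      rw [hTm, polarPart_mul_unitary _ _ v.1.2]
    have h2 : detC (u _ hgk) = detC (u g hg) := by
      apply Subtype.ext
      change (u _ hgk : Matrix (Fin d) (Fin d) ℂ).det = (u g hg : Matrix (Fin d) (Fin d) ℂ).det
      rw [h1, Matrix.UnitaryGroup.mul_val, Matrix.det_mul, show ((v : Matrix.unitaryGroup (Fin d) ℂ) : Matrix (Fin d) (Fin d) ℂ).det = 1 from v.2, mul_one]
    apply Subtype.ext
    change tens q d ((dlt d (detC (u _ hgk)))⁻¹ * u _ hgk) =
      tens q d ((dlt d (detC (u g hg)))⁻¹ * u g hg) * tens q d v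
    rw [← map_mul, h2, h1, mul_assoc]

lemma toCircle_pow (k : ZMod q) : (ZMod.toCircle k) ^ q = 1 := by
  rw [← AddChar.map_nsmul_eq_pow]
  simp

lemma exists_toCircle (w : Circle) (hw : w ^ q = 1) : ∃ k : ZMod q, ZMod.toCircle k = w := by
  obtain ⟨k, hk⟩ := (bijective_rootsOfUnityAddChar (n := q)).2 (rootsOfUnity.mkOfPowEq w hw)
  refine ⟨k, ?_⟩
  have := congrArg (fun z : rootsOfUnity q Circle => ((z : Circleˣ) : Circle)) hk
  simpa using this

/-- Deck transformation elements. -/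
noncomputable def dk : Multiplicative (ZMod q) →* SUg (Fin q × Fin d) where
  toFun k := ⟨tens q d (dlt d (ZMod.toCircle k.toAdd)), by
    change (tens q d _ : Matrix (Fin q × Fin d) (Fin q × Fin d) ℂ).det = 1
    rw [det_tens, det_dlt, ← Circle.coe_pow, toCircle_pow, Circle.coe_one]⟩
  map_one' := by
    apply Subtype.ext
    simp
  map_mul' a b := by
    apply Subtype.ext
    simp [AddChar.map_add_eq_mul]

lemma dk_conj (k : Multiplicative (ZMod q)) (g : SUg (Fin q × Fin d)) (hg : g ∈ KS q d) :
    (dk q d k)⁻¹ * g * dk q d k ∈ KS q d := by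
  obtain ⟨v, hv, h⟩ := (mem_KS q d g).1 hg
  refine (mem_KS q d _).2 ⟨(dlt d (ZMod.toCircle k.toAdd))⁻¹ * v * dlt d (ZMod.toCircle k.toAdd), ?_, ?_⟩
  · change (_ : Matrix (Fin d) (Fin d) ℂ).det = 1
    rw [← map_inv, Matrix.UnitaryGroup.mul_val, Matrix.UnitaryGroup.mul_val, Matrix.det_mul,
      Matrix.det_mul, det_dlt, det_dlt, show (v : Matrix (Fin d) (Fin d) ℂ).det = 1 from hv,
      Circle.coe_inv, mul_one]
    exact inv_mul_cancel₀ (Circle.coe_ne_zero _)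
  · rw [map_mul, map_mul, map_inv, h]; rfl

noncomputable instance deckAction : MulAction (Multiplicative (ZMod q)) (SUg (Fin q × Fin d) ⧸ KS q d) where
  smul k := Quotient.map' (· * dk q d k) (by
    intro a b h
    rw [QuotientGroup.leftRel_apply] at h ⊢
    simpa [mul_assoc] using dk_conj q d k _ h)
  one_smul x := by
    obtain ⟨g, rfl⟩ := QuotientGroup.mk_surjective x
    change ((g * dk q d 1 : SUg (Fin q × Fin d)) : SUg (Fin q × Fin d) ⧸ KS q d) = g
    simp
  mul_smul a b x := by
    obtain ⟨g, rfl⟩ := QuotientGroup.mk_surjective x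
    change ((g * dk q d (a * b) : SUg (Fin q × Fin d)) : SUg (Fin q × Fin d) ⧸ KS q d) =
      ((g * dk q d b * dk q d a : SUg (Fin q × Fin d)) : SUg (Fin q × Fin d) ⧸ KS q d)
    rw [mul_comm a b, map_mul, mul_assoc]

lemma deck_smul_mk (k : Multiplicative (ZMod q)) (g : SUg (Fin q × Fin d)) :
    k • (g : SUg (Fin q × Fin d) ⧸ KS q d) =
      ((g * dk q d k : SUg (Fin q × Fin d)) : SUg (Fin q × Fin d) ⧸ KS q d) := rfl

instance deck_cont : ContinuousConstSMul (Multiplicative (ZMod q)) (SUg (Fin q × Fin d) ⧸ KS q d) where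
  continuous_const_smul k := by
    rw [QuotientGroup.isOpenQuotientMap_mk.isQuotientMap.continuous_iff]
    exact QuotientGroup.continuous_mk.comp (continuous_mul_const (dk q d k))

instance deck_free : IsCancelSMul (Multiplicative (ZMod q)) (SUg (Fin q × Fin d) ⧸ KS q d) := by
  rw [isCancelSMul_iff_eq_one_of_smul_eq]
  intro k x h
  obtain ⟨g, rfl⟩ := QuotientGroup.mk_surjective x
  rw [deck_smul_mk, eq_comm, QuotientGroup.eq, inv_mul_cancel_left] at h
  obtain ⟨v, hv, h⟩ := (mem_KS q d _).1 h
  have h2 : v = dlt d (ZMod.toCircle k.toAdd) := tens_injective q d h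
  have h3 : (v : Matrix (Fin d) (Fin d) ℂ).det = 1 := hv
  rw [h2, det_dlt, Circle.coe_eq_one] at h3
  rw [← AddChar.map_zero_eq_one (ZMod.toCircle (N := q))] at h3
  exact ZMod.injective_toCircle h3

/-- The covering map. -/
def covP : SUg (Fin q × Fin d) ⧸ KS q d → Matrix.unitaryGroup (Fin q × Fin d) ℂ ⧸ oneTensorUnitary q d :=
  Quotient.map' (fun g => (g : Matrix.unitaryGroup (Fin q × Fin d) ℂ)) (by
    intro a b h
    rw [QuotientGroup.leftRel_apply] at h ⊢
    obtain ⟨v, hv, h⟩ := (mem_KS q d _).1 h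
    exact (mem_oneTensorUnitary q d _).2 ⟨v, h⟩)

lemma covP_mk (g : SUg (Fin q × Fin d)) : covP q d (g : SUg (Fin q × Fin d) ⧸ KS q d) =
    ((g : Matrix.unitaryGroup (Fin q × Fin d) ℂ) :
      Matrix.unitaryGroup (Fin q × Fin d) ℂ ⧸ oneTensorUnitary q d) := rfl

lemma continuous_covP : Continuous (covP q d) := by
  rw [QuotientGroup.isOpenQuotientMap_mk.isQuotientMap.continuous_iff]
  exact QuotientGroup.continuous_mk.comp continuous_subtype_val

lemma exists_SU_mul (g : Matrix.unitaryGroup (Fin q × Fin d) ℂ) :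
    ∃ (s : SUg (Fin q × Fin d)) (w : Circle), (s : Matrix.unitaryGroup (Fin q × Fin d) ℂ) * tens q d (dlt d w) = g := by
  obtain ⟨w, hw⟩ : ∃ w : Circle, w ^ q = detC g := by
    obtain ⟨x, hx⟩ := Circle.exp_surjective (detC g)
    refine ⟨Circle.exp (x / q), ?_⟩
    rw [← hx, ← Circle.exp_nsmul]
    congr 1
    rw [nsmul_eq_mul]
    field_simp [NeZero.ne q]
  refine ⟨⟨g * (tens q d (dlt d w))⁻¹, ?_⟩, w, by simp⟩
  change (_ : Matrix (Fin q × Fin d) (Fin q × Fin d) ℂ).det = 1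
  rw [← map_inv, ← map_inv, Matrix.UnitaryGroup.mul_val, Matrix.det_mul, det_tens, det_dlt,
    ← Circle.coe_pow, inv_pow, hw, Circle.coe_inv]
  exact mul_inv_cancel₀ (Circle.coe_ne_zero (detC g))

lemma isQuotientMap_covP : Topology.IsQuotientMap (covP q d) := by
  let m : SUg (Fin q × Fin d) × Circle → Matrix.unitaryGroup (Fin q × Fin d) ℂ :=
    fun p => p.1 * tens q d (dlt d p.2)
  have hm : Continuous m := (continuous_subtype_val.comp continuous_fst).mul
    ((continuous_tens q d).comp ((continuous_dlt d).comp continuous_snd))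
  have hms : Function.Surjective m := by
    intro g
    obtain ⟨s, w, h⟩ := exists_SU_mul q d g
    exact ⟨(s, w), h⟩
  have hmq : Topology.IsQuotientMap m := hm.isClosedMap.isQuotientMap hm hms
  have h1 := QuotientGroup.isOpenQuotientMap_mk (N := oneTensorUnitary q d) |>.isQuotientMap.comp hmq
  have h2 : (QuotientGroup.mk : _ → Matrix.unitaryGroup (Fin q × Fin d) ℂ ⧸ oneTensorUnitary q d) ∘ m
      = covP q d ∘ (fun p => (p.1 : SUg (Fin q × Fin d) ⧸ KS q d)) := by
    ext1 p
    exact QuotientGroup.mk_mul_of_mem _ ((mem_oneTensorUnitary q d _).2 ⟨_, rfl⟩)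
  rw [h2] at h1
  exact Topology.IsQuotientMap.of_comp (QuotientGroup.continuous_mk.comp continuous_fst) (continuous_covP q d) h1

lemma covP_eq_iff (x y : SUg (Fin q × Fin d) ⧸ KS q d) :
    covP q d x = covP q d y ↔ x ∈ MulAction.orbit (Multiplicative (ZMod q)) y := by
  obtain ⟨a, rfl⟩ := QuotientGroup.mk_surjective x
  obtain ⟨b, rfl⟩ := QuotientGroup.mk_surjective y
  rw [covP_mk, covP_mk, eq_comm, QuotientGroup.eq, mem_oneTensorUnitary]
  constructor
  · rintro ⟨v, hv⟩
    have hdet : (v : Matrix (Fin d) (Fin d) ℂ).det ^ q = 1 := by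
      rw [← det_tens, hv]
      exact (b⁻¹ * a).2
    obtain ⟨k, hk⟩ := exists_toCircle q (detC v) (by
      apply Subtype.ext
      rw [Circle.coe_pow]; exact hdet)
    refine ⟨Multiplicative.ofAdd k, ?_⟩
    change (Multiplicative.ofAdd k) • (b : SUg (Fin q × Fin d) ⧸ KS q d) = _
    rw [deck_smul_mk, QuotientGroup.eq, mem_KS]
    refine ⟨(dlt d (detC v))⁻¹ * v, ?_, ?_⟩
    · change (_ : Matrix (Fin d) (Fin d) ℂ).det = 1
      rw [← map_inv, Matrix.UnitaryGroup.mul_val, Matrix.det_mul, det_dlt, Circle.coe_inv]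
      exact inv_mul_cancel₀ (Circle.coe_ne_zero (detC v))
    · rw [map_mul, hv, map_inv, ← hk, mul_inv_rev]
      simp only [Subgroup.coe_mul, Subgroup.coe_inv, mul_assoc]
      rfl
  · rintro ⟨k, hk⟩
    change k • (b : SUg (Fin q × Fin d) ⧸ KS q d) = _ at hk
    rw [deck_smul_mk, QuotientGroup.eq, mem_KS] at hk
    obtain ⟨v, -, hv⟩ := hk
    refine ⟨dlt d (ZMod.toCircle k.toAdd) * v, ?_⟩
    rw [map_mul, hv, mul_inv_rev]
    change (dk q d k : Matrix.unitaryGroup (Fin q × Fin d) ℂ) * _ = _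
    simp only [Subgroup.coe_mul, Subgroup.coe_inv, mul_assoc, mul_inv_cancel_left]

lemma isQuotientCoveringMap_covP : IsQuotientCoveringMap (covP q d) (Multiplicative (ZMod q)) := by
  have : Finite (Multiplicative (ZMod q)) := inferInstanceAs (Finite (ZMod q))
  exact (isQuotientMap_covP q d).isQuotientCoveringMap_of_properlyDiscontinuousSMul
    (fun {x y} => covP_eq_iff q d x y)

end Final

/-- For `q, d ≥ 1`, the fundamental group of the coset space
`U(qd)/(I_q ⊗ U(d))` (at any basepoint) is cyclic of order `q`, i.e. isomorphic to `ℤ/qℤ`. -/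
theorem fundamentalGroup_unitary_mod_oneTensorUnitary (q d : ℕ) (hq : 1 ≤ q) (hd : 1 ≤ d)
    (x : Matrix.unitaryGroup (Fin q × Fin d) ℂ ⧸ oneTensorUnitary q d) :
    Nonempty (FundamentalGroup (Matrix.unitaryGroup (Fin q × Fin d) ℂ ⧸ oneTensorUnitary q d) x
      ≃* Multiplicative (ZMod q)) := by
  have : NeZero q := ⟨by omega⟩
  have : NeZero d := ⟨by omega⟩
  have hp := isQuotientCoveringMap_covP q d
  obtain ⟨e, he⟩ := hp.surjective x
  exact ⟨(hp.fundamentalGroupEquiv ⟨e, he⟩).trans MulOpposite.opMulEquiv.symm⟩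
end

section
/- Let q, d ≥ 1 be integers. The fundamental group of the quotient space U(d)^q/ΔU(d) is isomorphic to the quotient of ℤ^q by the subgroup generated by (1, 1, …, 1); in particular it is free abelian of rank q − 1. -/
/-- The diagonal subgroup `ΔU(d) = {(v, v, …, v) : v ∈ U(d)}` of the product group `U(d)^q`. -/
def diagonalUnitary (q d : ℕ) : Subgroup (Fin q → Matrix.unitaryGroup (Fin d) ℂ) where
  carrier := {u | ∃ v : Matrix.unitaryGroup (Fin d) ℂ, u = fun _ => v}
  one_mem' := ⟨1, rfl⟩
  mul_mem' := by
    rintro a b ⟨v, rfl⟩ ⟨w, rfl⟩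
    exact ⟨v * w, rfl⟩
  inv_mem' := by
    rintro a ⟨v, rfl⟩
    exact ⟨v⁻¹, rfl⟩

namespace UPow

set_option linter.unusedSectionVars false
open scoped unitInterval Matrix
open Matrix

section T
variable {ι : Type*} [Fintype ι] [DecidableEq ι]

/-- complex reflection -/
noncomputable def refl (c : ℂ) (w : ι → ℂ) : Matrix ι ι ℂ := 1 - c • vecMulVec w (star w)

lemma refl_mem (c : ℂ) (w : ι → ℂ) (h : c + star c = c * star c * (star w ⬝ᵥ w)) :
    refl c w ∈ unitaryGroup ι ℂ := by
  rw [mem_unitaryGroup_iff]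
  have e : star (refl c w) = 1 - (star c) • vecMulVec w (star w) := by
    simp [refl, star_eq_conjTranspose, conjTranspose_vecMulVec]
  rw [e, refl]
  simp only [sub_mul, mul_sub, one_mul, mul_one, smul_mul_assoc, mul_smul_comm,
    vecMulVec_mul_vecMulVec]
  ext i j
  simp only [Matrix.sub_apply, Matrix.smul_apply, vecMulVec_apply, Pi.smul_apply, smul_eq_mul]
  linear_combination (- w i * star w j) * h

lemma refl_mulVec (c : ℂ) (w z : ι → ℂ) : refl c w *ᵥ z = z - (c * (star w ⬝ᵥ z)) • w := by
  rw [refl, sub_mulVec, one_mulVec, smul_mulVec, vecMulVec_mulVec]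
  ext i; simp; ring

/-- transports `y` to `x` -/
noncomputable def T (x y : ι → ℂ) : Matrix ι ι ℂ :=
  refl (1 + star x ⬝ᵥ y)⁻¹ (x + y) * refl 2 y

lemma star_dot (x y : ι → ℂ) : star (star x ⬝ᵥ y) = star y ⬝ᵥ x := by
  simp [dotProduct, mul_comm]

lemma T_mem {x y : ι → ℂ} (hx : star x ⬝ᵥ x = 1) (hy : star y ⬝ᵥ y = 1)
    (h : 1 + star x ⬝ᵥ y ≠ 0) : T x y ∈ unitaryGroup ι ℂ := by
  have h' : 1 + star y ⬝ᵥ x ≠ 0 := by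
    rw [← star_dot x y]
    intro h0; apply h
    have := congrArg star h0
    simpa using this
  refine mul_mem (refl_mem _ _ ?_) (refl_mem _ _ ?_)
  · rw [star_inv₀, star_add, star_dot, star_one, star_add, add_dotProduct, dotProduct_add,
      dotProduct_add, hx, hy]
    field_simp
    ring
  · rw [hy]; norm_num

lemma T_mulVec {x y : ι → ℂ} (hy : star y ⬝ᵥ y = 1)
    (h : 1 + star x ⬝ᵥ y ≠ 0) : T x y *ᵥ y = x := by
  rw [T, ← mulVec_mulVec, refl_mulVec 2, hy]
  have : y - ((2:ℂ) * 1) • y = -y := by ext i; simp; ring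
  rw [this, mulVec_neg, refl_mulVec, star_add, add_dotProduct, hy, add_comm (star x ⬝ᵥ y),
    inv_mul_cancel₀ h]
  simp

lemma T_fix {x y z : ι → ℂ} (hx : star x ⬝ᵥ z = 0) (hy : star y ⬝ᵥ z = 0) : T x y *ᵥ z = z := by
  rw [T, ← mulVec_mulVec, refl_mulVec 2, hy]
  simp [refl_mulVec, add_dotProduct, hx, hy]

lemma T_self {y : ι → ℂ} (hy : star y ⬝ᵥ y = 1) : T y y = 1 := by
  have e : refl (1 + star y ⬝ᵥ y)⁻¹ (y + y) = refl 2 y := by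
    rw [hy, refl, refl]
    congr 1
    ext i j
    simp [vecMulVec_apply]; ring
  have e2 : star (refl 2 y) = refl 2 y := by
    simp [refl, star_eq_conjTranspose, conjTranspose_vecMulVec]
  rw [T, e]
  nth_rewrite 2 [← e2]
  rw [← mem_unitaryGroup_iff]
  refine refl_mem _ _ ?_
  rw [hy]; norm_num

lemma T_continuous {X : Type*} [TopologicalSpace X] {x y : X → ι → ℂ} (hx : Continuous x)
    (hy : Continuous y) (h : ∀ a, 1 + star (x a) ⬝ᵥ y a ≠ 0) :
    Continuous fun a => T (x a) (y a) := by
  unfold T refl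
  have h1 : Continuous fun a => (1 + star (x a) ⬝ᵥ y a)⁻¹ :=
    Continuous.inv₀ (by fun_prop) h
  fun_prop

abbrev E (ι : Type*) [Fintype ι] := EuclideanSpace ℂ ι

lemma dot_self (x : E ι) : star x.ofLp ⬝ᵥ x.ofLp = (‖x‖ : ℂ) ^ 2 := by
  have := inner_self_eq_norm_sq_to_K (𝕜 := ℂ) x
  rw [EuclideanSpace.inner_eq_star_dotProduct, dotProduct_comm] at this
  simpa using this

/-- `x` avoids the ray opposite to `p` -/
def Av (x p : E ι) : Prop := ∀ r : ℝ, 0 ≤ r → x ≠ -(r • p)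

noncomputable def nz (x : E ι) : E ι := ‖x‖⁻¹ • x

lemma Av.ne {x p : E ι} (h : Av x p) : x ≠ 0 := by simpa using h 0 le_rfl

lemma nz_norm {x : E ι} (h : x ≠ 0) : ‖nz x‖ = 1 := by
  rw [nz, norm_smul, norm_inv, norm_norm, inv_mul_cancel₀ (norm_ne_zero_iff.2 h)]

lemma nz_of_norm {x : E ι} (h : ‖x‖ = 1) : nz x = x := by simp [nz, h]

lemma dot_unit {x : E ι} (h : ‖x‖ = 1) : star x.ofLp ⬝ᵥ x.ofLp = 1 := by
  rw [dot_self, h]; simp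

lemma Av.dot {x p : E ι} (h : Av x p) (hp : ‖p‖ = 1) :
    1 + star (nz x).ofLp ⬝ᵥ p.ofLp ≠ 0 := by
  intro h0
  have hx := nz_norm h.ne
  have h1 : star (nz x).ofLp ⬝ᵥ p.ofLp = -1 := by linear_combination h0
  have h2 : star p.ofLp ⬝ᵥ (nz x).ofLp = -1 := by rw [← star_dot, h1]; simp
  have h3 : star (nz x + p).ofLp ⬝ᵥ (nz x + p).ofLp = 0 := by
    rw [WithLp.ofLp_add, star_add, add_dotProduct, dotProduct_add, dotProduct_add, h1, h2,
      dot_unit hx, dot_unit hp]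
    ring
  rw [dot_self] at h3
  have h4 : nz x + p = 0 := by simpa using h3
  refine h ‖x‖ (norm_nonneg _) ?_
  rw [← smul_neg, ← eq_neg_of_add_eq_zero_left h4, nz, smul_smul,
    mul_inv_cancel₀ (norm_ne_zero_iff.2 h.ne), one_smul]

/-- the transport from unit `p` to direction of `x`. -/
noncomputable def S (x p : E ι) : Matrix ι ι ℂ := T (nz x).ofLp p.ofLp

lemma S_mem {x p : E ι} (h : Av x p) (hp : ‖p‖ = 1) : S x p ∈ unitaryGroup ι ℂ :=
  T_mem (dot_unit (nz_norm h.ne)) (dot_unit hp) (h.dot hp)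

lemma S_mulVec {x p : E ι} (h : Av x p) (hp : ‖p‖ = 1) : S x p *ᵥ p.ofLp = (nz x).ofLp :=
  T_mulVec (dot_unit hp) (h.dot hp)

lemma S_self {p : E ι} (hp : ‖p‖ = 1) : S p p = 1 := by
  rw [S, nz_of_norm hp, T_self (dot_unit hp)]

lemma S_fix {x p : E ι} {i : ι} (hx : x i = 0) (hp : p i = 0) :
    S x p *ᵥ Pi.single i 1 = Pi.single i 1 :=
  T_fix (by simp [nz, hx]) (by simp [hp])

lemma S_continuous {X : Type*} [TopologicalSpace X] {x p : X → E ι} (hx : Continuous x)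
    (hp : Continuous p) (h : ∀ a, Av (x a) (p a)) (h' : ∀ a, ‖p a‖ = 1) :
    Continuous fun a => S (x a) (p a) := by
  refine T_continuous ?_ (by fun_prop) fun a => (h a).dot (h' a)
  have : Continuous fun a => ‖x a‖⁻¹ := Continuous.inv₀ (by fun_prop)
    fun a => norm_ne_zero_iff.2 (h a).ne
  unfold nz
  fun_prop

lemma star_fix {A : Matrix ι ι ℂ} (hA : A ∈ unitaryGroup ι ℂ) {y z : ι → ℂ} (h : A *ᵥ y = z) :
    star A *ᵥ z = y := by
  rw [← h, mulVec_mulVec, (mem_unitaryGroup_iff').1 hA, one_mulVec]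

lemma row_zero {A : Matrix ι ι ℂ} (hA : A ∈ unitaryGroup ι ℂ) {i : ι}
    (h : A *ᵥ Pi.single i 1 = Pi.single i 1) {a : ι} (ha : a ≠ i) : A i a = 0 := by
  have := congrFun (star_fix hA h) a
  rw [mulVec_single_one] at this
  simpa [ha, star_eq_conjTranspose] using this

lemma col_norm {A : Matrix ι ι ℂ} (hA : A ∈ unitaryGroup ι ℂ) (a : ι) :
    ‖(WithLp.toLp 2 (A *ᵥ Pi.single a 1) : E ι)‖ = 1 := by
  have h := dot_self (WithLp.toLp 2 (A *ᵥ Pi.single a 1) : E ι)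
  simp only [star_mulVec, ← dotProduct_mulVec] at h
  rw [mulVec_mulVec, ← star_eq_conjTranspose, (mem_unitaryGroup_iff').1 hA, one_mulVec] at h
  have h1 : (‖(WithLp.toLp 2 (A *ᵥ Pi.single a 1) : E ι)‖)^2 = (1:ℝ) := by
    have h2 : star (Pi.single a 1 : ι → ℂ) ⬝ᵥ Pi.single a 1 = 1 := by simp
    rw [h2] at h
    exact_mod_cast h.symm
  exact (pow_eq_one_iff_of_nonneg (norm_nonneg _) two_ne_zero).1 h1

end T

section H
variable {ι : Type*} [Fintype ι] [DecidableEq ι]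

lemma mkHomotopy (γ : Path (1 : unitaryGroup ι ℂ) 1) (H : I × I → Matrix ι ι ℂ)
    (hm : ∀ x, H x ∈ unitaryGroup ι ℂ) (hc : Continuous H) (h0 : ∀ t, H (0, t) = γ t)
    (hs0 : ∀ s, H (s, 0) = 1) (hs1 : ∀ s, H (s, 1) = 1) :
    ∃ γ' : Path (1 : unitaryGroup ι ℂ) 1, γ.Homotopic γ' ∧
      ∀ t, (γ' t : Matrix ι ι ℂ) = H (1, t) := by
  refine ⟨⟨⟨fun t => ⟨H (1, t), hm _⟩, by fun_prop⟩, Subtype.ext (hs0 1), Subtype.ext (hs1 1)⟩,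
    ⟨⟨⟨⟨fun x => ⟨H x, hm x⟩, by fun_prop⟩, fun t => Subtype.ext (h0 t), fun t => rfl⟩, ?_⟩⟩,
    fun t => rfl⟩
  rintro s t (rfl | rfl)
  · exact Subtype.ext (by simp [hs0])
  · exact Subtype.ext (by simp [hs1])

/-- `γ` fixes the basis vectors in `s`. -/
def Fix (γ : Path (1 : unitaryGroup ι ℂ) 1) (s : Finset ι) : Prop :=
  ∀ t, ∀ i ∈ s, (γ t : Matrix ι ι ℂ) *ᵥ Pi.single i 1 = Pi.single i 1

/-- the moving column -/
noncomputable def col (γ : Path (1 : unitaryGroup ι ℂ) 1) (a : ι) : C(I, E ι) :=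
  ⟨fun t => WithLp.toLp 2 ((γ t : Matrix ι ι ℂ) *ᵥ Pi.single a 1), by fun_prop⟩

lemma col_apply (γ : Path (1 : unitaryGroup ι ℂ) 1) (a : ι) (t : I) :
    (col γ a t).ofLp = (γ t : Matrix ι ι ℂ) *ᵥ Pi.single a 1 := rfl

lemma col_nm (γ : Path (1 : unitaryGroup ι ℂ) 1) (a : ι) (t : I) : ‖col γ a t‖ = 1 :=
  col_norm (γ t).2 a

lemma col_zero (γ : Path (1 : unitaryGroup ι ℂ) 1) (a : ι) :
    col γ a 0 = WithLp.toLp 2 (Pi.single a 1) := by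
  ext1; rw [col_apply]; simp [Matrix.one_apply, Pi.single_apply]

lemma col_one (γ : Path (1 : unitaryGroup ι ℂ) 1) (a : ι) :
    col γ a 1 = WithLp.toLp 2 (Pi.single a 1) := by
  ext1; rw [col_apply]; simp [Matrix.one_apply, Pi.single_apply]

lemma col_supp {γ : Path (1 : unitaryGroup ι ℂ) 1} {s : Finset ι} (h : Fix γ s) {a : ι}
    (ha : a ∉ s) (t : I) {i : ι} (hi : i ∈ s) : col γ a t i = 0 := by
  have := row_zero (γ t).2 (h t i hi) (a := a) (by rintro rfl; exact ha hi)
  simpa [col] using this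

lemma av_of_close {x p : E ι} (hp : ‖p‖ = 1) (h : ‖x - p‖ < 1) : Av x p := by
  rintro r hr rfl
  have : -(r • p) - p = -((r + 1) • p) := by rw [add_smul, one_smul]; abel
  rw [this, norm_neg, norm_smul, hp, Real.norm_of_nonneg (by linarith)] at h
  linarith

lemma step1 {γ : Path (1 : unitaryGroup ι ℂ) 1} {s : Finset ι} (h : Fix γ s) {a : ι}
    (ha : a ∉ s) : ∃ γ' : Path (1 : unitaryGroup ι ℂ) 1, γ.Homotopic γ' ∧ Fix γ' s ∧
      ∃ v : ℝ → ι → ℂ, (∀ i, ContDiff ℝ 1 (fun t => v t i)) ∧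
        ∀ t : I, ∃ r : ℝ, ∀ i, col γ' a t i = (r : ℂ) * v t i := by
  have hB := bernsteinApproximation_uniform (col γ a)
  obtain ⟨n, hn, hn0⟩ := ((hB.eventually (Metric.ball_mem_nhds _ one_pos)).and
    (Filter.eventually_ne_atTop 0)).exists
  set w := bernsteinApproximation n (col γ a) with hw
  have hd : ∀ t, ‖w t - col γ a t‖ < 1 := fun t => by
    rw [← dist_eq_norm]
    exact (ContinuousMap.dist_apply_le_dist t).trans_lt hn
  have hw0 : w 0 = col γ a 0 := by simp [hw]
  have hw1 : w 1 = col γ a 1 := by simp [hw, hn0]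
  have hws : ∀ t, ∀ i ∈ s, w t i = 0 := fun t i hi => by
    rw [hw, bernsteinApproximation.apply]
    simp [col_supp h ha _ hi]
  let u : I × I → E ι := fun x => col γ a x.2 + (x.1 : ℝ) • (w x.2 - col γ a x.2)
  have hu : ∀ x, Av (u x) (col γ a x.2) := fun x => by
    refine av_of_close (col_nm _ _ _) ?_
    simp only [u, add_sub_cancel_left, norm_smul]
    have h1 : ‖(x.1 : ℝ)‖ ≤ 1 := by
      rw [Real.norm_of_nonneg x.1.2.1]; exact x.1.2.2
    calc _ ≤ 1 * ‖w x.2 - col γ a x.2‖ := by gcongr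
      _ < 1 := by rw [one_mul]; exact hd _
  have huc : Continuous u := by fun_prop
  obtain ⟨γ', h1, h2⟩ := mkHomotopy γ (fun x => S (u x) (col γ a x.2) * (γ x.2 : Matrix ι ι ℂ))
    (fun x => mul_mem (S_mem (hu x) (col_nm _ _ _)) (γ x.2).2)
    ((S_continuous huc (by fun_prop) hu fun x => col_nm _ _ _).mul (by fun_prop))
    (fun t => by simp [u, S_self (col_nm γ a t)])
    (fun t => by simp [u, hw0, S_self (col_nm γ a 0)])
    (fun t => by simp [u, hw1, S_self (col_nm γ a 1)])
  have hu1 : ∀ t, u (1, t) = w t := fun t => by simp [u]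
  refine ⟨γ', h1, ?_, fun t i => ∑ k : Fin (n + 1), 
    ((n.choose k : ℝ) * t ^ (k : ℕ) * (1 - t) ^ (n - k)) • col γ a (bernstein.z k) i, ?_, ?_⟩
  · intro t i hi
    rw [h2, ← mulVec_mulVec, h t i hi, hu1]
    exact S_fix (hws t i hi) (col_supp h ha t hi)
  · intro i; fun_prop
  · intro t
    refine ⟨‖w t‖⁻¹, fun i => ?_⟩
    have e : (col γ' a t) = nz (w t) := by
      ext1
      rw [col_apply, h2, ← mulVec_mulVec, ← col_apply, S_mulVec (hu (1, t)) (col_nm _ _ _), hu1]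
    rw [e, nz, PiLp.smul_apply, Complex.real_smul, hw, bernsteinApproximation.apply]
    congr 1
    simp [bernstein_apply]

lemma exists_p (f g : ℝ → ℂ) (hf : ContDiff ℝ 1 f) (hg : ContDiff ℝ 1 g) :
    ∃ z w : ℂ, ∀ r t : ℝ, (z, w) ≠ (r * f t, r * g t) := by
  have hF : ContDiff ℝ 1 (fun x : ℝ × ℝ => ((x.1 : ℂ) * f x.2, (x.1 : ℂ) * g x.2)) := by
    have : ContDiff ℝ 1 (fun x : ℝ => (x : ℂ)) := Complex.ofRealCLM.contDiff
    fun_prop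
  have := hF.dense_compl_range_of_finrank_lt_finrank (by simp [Complex.finrank_real_complex])
  obtain ⟨⟨z, w⟩, h⟩ := this.nonempty
  exact ⟨z, w, fun r t e => h ⟨(r, t), e.symm⟩⟩

lemma av_cvx {x p : E ι} (hp : ‖p‖ = 1) (h : Av x p) (s : I) : Av (x + (s : ℝ) • (p - x)) p := by
  intro r hr e
  have hp0 : p ≠ 0 := by rintro rfl; simp at hp
  have e1 : (1 - (s : ℝ)) • x = -((r + s) • p) := by
    rw [add_smul, sub_smul, one_smul, neg_add, ← e]; rw [smul_sub]; abel
  have hs := s.2.1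
  rcases eq_or_lt_of_le s.2.2 with h1 | h1
  · rw [h1, sub_self, zero_smul, zero_eq_neg, smul_eq_zero] at e1
    rcases e1 with e1 | e1
    · linarith
    · exact hp0 e1
  · have h2 : (0 : ℝ) < 1 - s := by linarith
    refine h ((1 - (s : ℝ))⁻¹ * (r + s)) (by positivity) ?_
    rw [← smul_smul, ← smul_neg, ← e1, smul_smul, inv_mul_cancel₀ h2.ne', one_smul]

lemma step2 {γ : Path (1 : unitaryGroup ι ℂ) 1} {s : Finset ι} (h : Fix γ s) {a b : ι}
    (ha : a ∉ s) (hb : b ∉ s) (hab : a ≠ b)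
    (v : ℝ → ι → ℂ) (hv : ∀ i, ContDiff ℝ 1 (fun t => v t i))
    (hr : ∀ t : I, ∃ r : ℝ, ∀ i, col γ a t i = (r : ℂ) * v t i) :
    ∃ γ' : Path (1 : unitaryGroup ι ℂ) 1, γ.Homotopic γ' ∧ Fix γ' (insert a s) := by
  obtain ⟨z, w, hzw⟩ := exists_p _ _ (hv a) (hv b)
  let p0 : E ι := WithLp.toLp 2 (Pi.single a z + Pi.single b w)
  have p0a : p0 a = z := by simp [p0, hab]
  have p0b : p0 b = w := by simp [p0, hab.symm]
  have p0s : ∀ i ∈ s, p0 i = 0 := fun i hi => by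
    have h1 : i ≠ a := by rintro rfl; exact ha hi
    have h2 : i ≠ b := by rintro rfl; exact hb hi
    simp [p0, h1, h2]
  have hp0 : p0 ≠ 0 := by
    intro e
    refine hzw 0 0 ?_
    rw [← p0a, ← p0b, e]; simp
  let p := nz p0
  have hp : ‖p‖ = 1 := nz_norm hp0
  have ps : ∀ i ∈ s, p i = 0 := fun i hi => by simp [p, nz, p0s i hi]
  have hav : ∀ t, Av (col γ a t) p := by
    intro t r hr0 e
    obtain ⟨r', hr'⟩ := hr t
    have hr1 : r ≠ 0 := by
      rintro rfl
      have := col_nm γ a t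
      rw [e] at this; simp at this
    have key : ∀ i, p0 i = ((-(‖p0‖ * r⁻¹ * r') : ℝ) : ℂ) * v t i := by
      intro i
      have h1 := hr' i
      rw [e] at h1
      simp only [p, nz, PiLp.neg_apply, PiLp.smul_apply, Complex.real_smul] at h1
      have h2 : (‖p0‖ : ℂ) ≠ 0 := by exact_mod_cast norm_ne_zero_iff.2 hp0
      have h3 : (r : ℂ) ≠ 0 := by exact_mod_cast hr1
      push_cast at h1 ⊢
      rw [neg_mul, mul_assoc, ← h1]
      field_simp
    refine hzw (-(‖p0‖ * r⁻¹ * r')) t (Prod.ext ?_ ?_)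
    · rw [← p0a]; exact key a
    · rw [← p0b]; exact key b
  let e : E ι := WithLp.toLp 2 (Pi.single a 1)
  have he0 : col γ a 0 = e := col_zero γ a
  have he1 : col γ a 1 = e := col_one γ a
  have hae : Av e p := he0 ▸ hav 0
  have hes : ∀ i ∈ s, e i = 0 := fun i hi => he0 ▸ col_supp h ha 0 hi
  let c : I → E ι → E ι := fun s x => x + (s : ℝ) • (p - x)
  have c0 : ∀ x, c 0 x = x := fun x => by simp [c]
  have c1 : ∀ x, c 1 x = p := fun x => by simp [c]
  have mE := S_mem hae hp
  have mc : ∀ s, S (c s e) p ∈ unitaryGroup ι ℂ := fun s => S_mem (av_cvx hp hae s) hp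
  have mv : ∀ s t, S (c s (col γ a t)) p ∈ unitaryGroup ι ℂ :=
    fun s t => S_mem (av_cvx hp (hav t) s) hp
  have mw : ∀ t, S (col γ a t) p ∈ unitaryGroup ι ℂ := fun t => S_mem (hav t) hp
  have Cc : Continuous fun x : I × I => S (c x.1 e) p :=
    S_continuous (by fun_prop) (by fun_prop) (fun x => av_cvx hp hae x.1) fun _ => hp
  have Cv : Continuous fun x : I × I => S (c x.1 (col γ a x.2)) p :=
    S_continuous (by fun_prop) (by fun_prop) (fun x => av_cvx hp (hav x.2) x.1) fun _ => hp
  have Cw : Continuous fun x : I × I => S (col γ a x.2) p :=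
    S_continuous (by fun_prop) (by fun_prop) (fun x => hav x.2) fun _ => hp
  obtain ⟨γ', h1, h2⟩ := mkHomotopy γ
    (fun x => S e p * star (S (c x.1 e) p) * S (c x.1 (col γ a x.2)) p * star (S (col γ a x.2) p)
      * (γ x.2 : Matrix ι ι ℂ))
    (fun x => mul_mem (mul_mem (mul_mem (mul_mem mE (Unitary.star_mem (mc _))) (mv _ _))
      (Unitary.star_mem (mw _))) (γ x.2).2)
    ((((continuous_const.mul Cc.star).mul Cv).mul Cw.star).mul (by fun_prop))
    (fun t => by
      simp only [c0]
      rw [mem_unitaryGroup_iff.1 mE, one_mul, mem_unitaryGroup_iff.1 (mw t), one_mul])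
    (fun t => by
      simp only [he0]
      rw [mul_assoc (S e p), mem_unitaryGroup_iff'.1 (mc t), mul_one, mem_unitaryGroup_iff.1 mE]
      simp)
    (fun t => by
      simp only [he1]
      rw [mul_assoc (S e p), mem_unitaryGroup_iff'.1 (mc t), mul_one, mem_unitaryGroup_iff.1 mE]
      simp)
  refine ⟨γ', h1, fun t i hi => ?_⟩
  rw [h2]
  simp only [c1, S_self hp, star_one, mul_one, ← mulVec_mulVec]
  rcases Finset.mem_insert.1 hi with rfl | hi
  · have : (γ t : Matrix ι ι ℂ) *ᵥ Pi.single i 1 = (nz (col γ i t)).ofLp := by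
      rw [nz_of_norm (col_nm _ _ _)]; rfl
    rw [this, star_fix (mw t) (S_mulVec (hav t) hp), S_mulVec hae hp]
    rw [nz_of_norm (he0 ▸ col_nm γ i 0)]
  · rw [h t i hi, star_fix (mw t) (S_fix (col_supp h ha t hi) (ps i hi)),
      S_fix (hes i hi) (ps i hi)]

lemma reduce (γ : Path (1 : unitaryGroup ι ℂ) 1) (b : ι) :
    ∀ s : Finset ι, b ∉ s → ∃ γ' : Path (1 : unitaryGroup ι ℂ) 1, γ.Homotopic γ' ∧ Fix γ' s := by
  intro s
  induction s using Finset.induction_on with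
  | empty => exact fun _ => ⟨γ, .refl γ, fun t i hi => by simp at hi⟩
  | insert a s ha ih =>
    intro hb
    rw [Finset.mem_insert, not_or] at hb
    obtain ⟨γ₁, h1, f1⟩ := ih hb.2
    obtain ⟨γ₂, h2, f2, v, hv, hr⟩ := step1 f1 ha
    obtain ⟨γ₃, h3, f3⟩ := step2 f2 ha hb.2 (Ne.symm hb.1) v hv hr
    exact ⟨γ₃, (h1.trans h2).trans h3, f3⟩

/-- diagonal embedding of the circle -/
noncomputable def D (b : ι) : C(Circle, unitaryGroup ι ℂ) :=
  ⟨fun z => ⟨diagonal (Function.update 1 b (z : ℂ)), by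
    rw [mem_unitaryGroup_iff, star_eq_conjTranspose, diagonal_conjTranspose, diagonal_mul_diagonal,
      ← diagonal_one]
    congr 1
    ext i
    by_cases hi : i = b
    · subst hi; simp [Complex.mul_conj, Circle.normSq_coe]
    · simp [hi]⟩, by
    have : Continuous fun z : Circle => (z : ℂ) := by fun_prop
    refine Continuous.subtype_mk ?_ _
    refine Continuous.matrix_diagonal ?_
    exact continuous_const.update b this⟩

noncomputable def detC : C(unitaryGroup ι ℂ, Circle) :=
  ⟨fun A => ⟨A.1.det, by
    have := det_of_mem_unitary A.2
    exact mem_sphere_zero_iff_norm.2 (CStarRing.norm_of_mem_unitary this)⟩, by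
    refine Continuous.subtype_mk ?_ _
    fun_prop⟩

end H

section P
variable {ι : Type*} [Fintype ι] [DecidableEq ι]

lemma D_one (b : ι) : D b 1 = 1 := by
  apply Subtype.ext
  change diagonal (Function.update 1 b ((1 : Circle) : ℂ)) = 1
  rw [Circle.coe_one, ← diagonal_one]
  congr 1
  ext i
  by_cases hi : i = b
  · subst hi; simp
  · simp [hi]

lemma det_D (b : ι) (z : Circle) : detC (D b z) = z := by
  apply Subtype.ext
  change (diagonal (Function.update 1 b (z : ℂ))).det = z
  rw [det_diagonal, Finset.prod_update_of_mem (Finset.mem_univ b)]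
  simp

lemma det_one : detC (1 : unitaryGroup ι ℂ) = 1 := by
  apply Subtype.ext
  change (1 : Matrix ι ι ℂ).det = 1
  simp

lemma eq_D {A : unitaryGroup ι ℂ} {b : ι}
    (h : ∀ i, i ≠ b → (A : Matrix ι ι ℂ) *ᵥ Pi.single i 1 = Pi.single i 1) :
    A = D b (detC A) := by
  have h1 : (A : Matrix ι ι ℂ) = diagonal (Function.update 1 b (A.1 b b)) := by
    ext i j
    by_cases hj : j = b
    · subst hj
      by_cases hi : i = j
      · subst hi; simp
      · rw [diagonal_apply_ne _ hi]
        exact row_zero A.2 (h i hi) (Ne.symm hi)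
    · have := congrFun (h j hj) i
      rw [mulVec_single_one] at this
      by_cases hi : i = j
      · subst hi; simpa [hj] using this
      · rw [diagonal_apply_ne _ hi]; simpa [hi] using this
  have h2 : A.1.det = A.1 b b := by
    conv_lhs => rw [h1]
    rw [det_diagonal, Finset.prod_update_of_mem (Finset.mem_univ b)]
    simp
  apply Subtype.ext
  change _ = diagonal (Function.update 1 b A.1.det)
  rw [h2]; exact h1

open FundamentalGroup in
lemma map_bij (b : ι) : Function.Bijective (mapOfEq (D b) (D_one b)) := by
  constructor
  · intro p q h
    have hinv : ∀ r : FundamentalGroup Circle 1,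
        mapOfEq detC det_one (mapOfEq (D b) (D_one b) r) = r := by
      intro r
      rw [mapOfEq_apply, mapOfEq_apply]
      induction r using Path.Homotopic.Quotient.ind with | mk r =>
      change Path.Homotopic.Quotient.mk _ = Path.Homotopic.Quotient.mk r
      congr 1
      ext t
      simp [det_D]
    rw [← hinv p, h, hinv]
  · intro p
    induction p using Path.Homotopic.Quotient.ind with | mk γ =>
    obtain ⟨γ', h, hf⟩ := reduce γ b (Finset.univ.erase b) (by simp)
    let δ : Path (1 : Circle) 1 := (γ'.map detC.continuous).cast det_one.symm det_one.symm
    refine ⟨Path.Homotopic.Quotient.mk δ, ?_⟩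
    rw [mapOfEq_apply, Path.Homotopic.Quotient.eq.2 h]
    change Path.Homotopic.Quotient.mk _ = Path.Homotopic.Quotient.mk _
    congr 1
    ext1
    funext t
    exact (eq_D fun i hi => hf t i (by simp [hi])).symm

noncomputable def homeoEquiv {X Y : Type*} [TopologicalSpace X] [TopologicalSpace Y] (h : X ≃ₜ Y)
    (x : X) : FundamentalGroup X x ≃* FundamentalGroup Y (h x) :=
  MulEquiv.ofBijective (FundamentalGroup.map (h : C(X, Y)) x) <| by
    constructor
    · intro p q e
      have hinv : ∀ r : FundamentalGroup X x, FundamentalGroup.mapOfEq (h.symm : C(Y, X))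
          (h.symm_apply_apply x) (FundamentalGroup.map (h : C(X, Y)) x r) = r := by
        intro r
        rw [FundamentalGroup.mapOfEq_apply]
        induction r using Path.Homotopic.Quotient.ind with | mk r =>
        change Path.Homotopic.Quotient.mk _ = Path.Homotopic.Quotient.mk r
        congr 1
        ext t
        simp
      rw [← hinv p, e, hinv]
    · intro p
      induction p using Path.Homotopic.Quotient.ind with | mk γ =>
      refine ⟨Path.Homotopic.Quotient.mk ((γ.map h.symm.continuous).cast
        (h.symm_apply_apply x).symm (h.symm_apply_apply x).symm), ?_⟩
      change Path.Homotopic.Quotient.mk _ = Path.Homotopic.Quotient.mk _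
      congr 1
      ext t
      simp

noncomputable def piEquiv {J : Type*} {X : J → Type*} [∀ j, TopologicalSpace (X j)] (x : ∀ j, X j) :
    FundamentalGroup (∀ j, X j) x ≃* ∀ j, FundamentalGroup (X j) (x j) :=
  MulEquiv.ofBijective (MonoidHom.pi fun j =>
    FundamentalGroup.map (⟨fun y => y j, continuous_apply j⟩ : C(∀ j, X j, X j)) x) <| by
    constructor
    · intro p q e
      rw [← Path.Homotopic.pi_proj p, ← Path.Homotopic.pi_proj q]
      congr 1
    · intro p
      exact ⟨Path.Homotopic.pi p, funext fun j => Path.Homotopic.proj_pi j p⟩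

noncomputable def circleEquiv : FundamentalGroup Circle 1 ≃* Multiplicative ℤ :=
  let e := (homeoEquiv (AddCircle.homeomorphCircle (one_ne_zero (α := ℝ))) 0)
  let e1 := (AddCircle.isAddQuotientCoveringMap_coe (1 : ℝ)).fundamentalGroupEquiv
    (x := 0) ⟨(0 : ℝ), rfl⟩
  have h0 : AddCircle.homeomorphCircle (one_ne_zero (α := ℝ)) 0 = 1 := by
    rw [AddCircle.homeomorphCircle_apply, AddCircle.toCircle_zero]
  have hz : AddSubgroup.zmultiples (1 : ℝ) = (Int.castAddHom ℝ).range := by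
    ext; simp [AddSubgroup.mem_zmultiples_iff]
  let e2 : ℤ ≃+ AddSubgroup.zmultiples (1 : ℝ) :=
    (AddMonoidHom.ofInjective (f := Int.castAddHom ℝ) Int.cast_injective).trans
      (AddEquiv.addSubgroupCongr hz.symm)
  (h0 ▸ e.symm).trans (e1.trans
    ((MulOpposite.opMulEquiv (M := Multiplicative (AddSubgroup.zmultiples (1 : ℝ)))).symm.trans
      e2.symm.toMultiplicative))

noncomputable def unitaryEquiv (b : ι) (y : unitaryGroup ι ℂ) :
    FundamentalGroup (unitaryGroup ι ℂ) y ≃* Multiplicative ℤ :=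
  have h : Homeomorph.mulLeft y 1 = y := by simp
  (h ▸ (homeoEquiv (Homeomorph.mulLeft y) 1).symm).trans
    ((MulEquiv.ofBijective _ (map_bij b)).symm.trans circleEquiv)

def quotHom (n : ℕ) : (Fin (n + 1) → ℤ) →+ (Fin n → ℤ) where
  toFun v i := v i.succ - v 0
  map_zero' := by ext; simp
  map_add' v w := by ext i; simp; ring

noncomputable def quotEquiv (n : ℕ) :
    ((Fin (n + 1) → ℤ) ⧸ AddSubgroup.zmultiples (fun _ => (1 : ℤ) : Fin (n + 1) → ℤ))
      ≃+ (Fin n → ℤ) :=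
  (QuotientAddGroup.quotientAddEquivOfEq (by
    ext v
    rw [AddSubgroup.mem_zmultiples_iff, AddMonoidHom.mem_ker]
    constructor
    · rintro ⟨k, rfl⟩
      ext i
      simp [quotHom]
    · intro h
      refine ⟨v 0, ?_⟩
      ext i
      refine Fin.cases ?_ (fun j => ?_) i
      · simp
      · have := congrFun h j
        simp [quotHom] at this
        simp; omega)).trans
  (QuotientAddGroup.quotientKerEquivOfSurjective (quotHom n) fun w =>
    ⟨Fin.cons 0 w, by ext i; simp [quotHom]⟩)

def quotHomeo (n d : ℕ) : ((Fin (n + 1) → unitaryGroup (Fin d) ℂ) ⧸ diagonalUnitary (n + 1) d) ≃ₜ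
    (Fin n → unitaryGroup (Fin d) ℂ) where
  toFun := Quotient.lift (fun u i => u i.succ * (u 0)⁻¹) (by
    intro u w h
    obtain ⟨v, hv⟩ := QuotientGroup.leftRel_apply.1 h
    have hw : ∀ i, w i = u i * v := fun i => by
      have := congrFun hv i
      simp only [Pi.mul_apply, Pi.inv_apply] at this
      rw [← this]; simp
    funext i
    simp [hw])
  invFun w := QuotientGroup.mk (Fin.cons 1 w)
  left_inv := by
    intro x
    induction x using QuotientGroup.induction_on with | H u =>
    refine QuotientGroup.eq.2 ⟨u 0, ?_⟩
    funext i
    refine Fin.cases ?_ (fun j => ?_) i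
    · simp
    · simp only [Pi.mul_apply, Pi.inv_apply, Fin.cons_succ]
      change (u j.succ * (u 0)⁻¹)⁻¹ * u j.succ = u 0
      simp
  right_inv := by
    intro w
    funext i
    change (Fin.cons 1 w : Fin (n+1) → unitaryGroup (Fin d) ℂ) i.succ *
      ((Fin.cons 1 w : Fin (n+1) → unitaryGroup (Fin d) ℂ) 0)⁻¹ = w i
    simp
  continuous_toFun := Continuous.quotient_lift (by fun_prop) _
  continuous_invFun := by
    refine continuous_quotient_mk'.comp ?_
    refine continuous_pi fun i => ?_
    refine Fin.cases ?_ (fun j => ?_) i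
    · simpa using continuous_const
    · simpa using continuous_apply j

noncomputable def finalEquiv (n d : ℕ) (hd : 1 ≤ d)
    (x : (Fin (n + 1) → unitaryGroup (Fin d) ℂ) ⧸ diagonalUnitary (n + 1) d) :
    FundamentalGroup ((Fin (n + 1) → unitaryGroup (Fin d) ℂ) ⧸ diagonalUnitary (n + 1) d) x
      ≃* Multiplicative (Fin n → ℤ) :=
  (homeoEquiv (quotHomeo n d) x).trans ((piEquiv _).trans
    ((MulEquiv.piCongrRight fun _ => unitaryEquiv ⟨0, hd⟩ _).trans
      (MulEquiv.piMultiplicative fun _ : Fin n => ℤ).symm))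

end P
end UPow

/-- For `q, d ≥ 1`, the fundamental group of the coset space `U(d)^q/ΔU(d)`
(at any basepoint) is isomorphic to the quotient of `ℤ^q` by the subgroup generated by
`(1, 1, …, 1)`; in particular it is free abelian of rank `q − 1`. -/
theorem fundamentalGroup_unitary_pow_mod_diagonal (q d : ℕ) (hq : 1 ≤ q) (hd : 1 ≤ d)
    (x : (Fin q → Matrix.unitaryGroup (Fin d) ℂ) ⧸ diagonalUnitary q d) :
    Nonempty (FundamentalGroup ((Fin q → Matrix.unitaryGroup (Fin d) ℂ) ⧸ diagonalUnitary q d) x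
        ≃* Multiplicative
            ((Fin q → ℤ) ⧸ AddSubgroup.zmultiples (fun _ => (1 : ℤ) : Fin q → ℤ))) ∧
    Nonempty (FundamentalGroup ((Fin q → Matrix.unitaryGroup (Fin d) ℂ) ⧸ diagonalUnitary q d) x
        ≃* Multiplicative (Fin (q - 1) → ℤ)) := by
  obtain ⟨n, rfl⟩ : ∃ n, q = n + 1 := ⟨q - 1, by omega⟩
  refine ⟨⟨(UPow.finalEquiv n d hd x).trans (UPow.quotEquiv n).symm.toMultiplicative⟩,
    ⟨UPow.finalEquiv n d hd x⟩⟩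
end
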